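/- Let P be a frame polyomino. Then the h-polynomial of K[P] equals the switching rook polynomial of P, i.e. h(t) = r̃_P(t) = Σ_{k=0}^{r_P} r̃_k t^k. -/

import Mathlib

noncomputable section

open scoped BigOperators

/-! ## Polyominoes -/

/-- Two cells of `ℤ²` (identified with their lower left corners) share an edge. -/
def cellAdj (c d : ℤ × ℤ) : Prop :=
  (c.1 = d.1 ∧ (d.2 = c.2 + 1 ∨ c.2 = d.2 + 1)) ∨
  (c.2 = d.2 ∧ (d.1 = c.1 + 1 ∨ c.1 = d.1 + 1))

/-- A polyomino: a nonempty finite collection of cells of `ℤ²` any two of which are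
connected by a path of cells of the collection in which consecutive cells share an edge. -/
structure Polyomino : Type where
  cells : Finset (ℤ × ℤ)
  nonempty : cells.Nonempty
  connected : ∀ c ∈ cells, ∀ d ∈ cells,
    Relation.ReflTransGen (fun u v => u ∈ cells ∧ v ∈ cells ∧ cellAdj u v) c d

/-- The four vertices of the cell with lower left corner `c`. -/
def cellVertices (c : ℤ × ℤ) : Finset (ℤ × ℤ) :=
  {c, (c.1 + 1, c.2), (c.1, c.2 + 1), (c.1 + 1, c.2 + 1)}

/-- The vertex set `V(P)` of a polyomino. -/
def Polyomino.vertexSet (P : Polyomino) : Finset (ℤ × ℤ) :=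
  P.cells.biUnion cellVertices

/-- The rank of `P`: the number of its cells. -/
def Polyomino.rank (P : Polyomino) : ℕ := P.cells.card

/-- The cell with lower left corner `c` is contained in the interval `[a, b]` of `ℤ²`. -/
def cellInInterval (a b c : ℤ × ℤ) : Prop :=
  a.1 ≤ c.1 ∧ c.1 + 1 ≤ b.1 ∧ a.2 ≤ c.2 ∧ c.2 + 1 ≤ b.2

/-- `[a, b]` is an inner interval of the polyomino `P`: it is a proper interval all of whose
cells belong to `P`. -/
def IsInnerInterval (P : Polyomino) (a b : ℤ × ℤ) : Prop :=
  a.1 < b.1 ∧ a.2 < b.2 ∧ ∀ c : ℤ × ℤ, cellInInterval a b c → c ∈ P.cells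

/-! ## North-east paths, parallelogram and frame polyominoes -/

/-- A north-east path: consecutive points form east or north steps. -/
def IsNEPath (L : List (ℤ × ℤ)) : Prop :=
  L ≠ [] ∧ L.Chain' (fun u v => v = (u.1 + 1, u.2) ∨ v = (u.1, u.2 + 1))

/-- The path `L` contains the east step from `(x, h)` to `(x + 1, h)`. -/
def eastStepOf (L : List (ℤ × ℤ)) (x h : ℤ) : Prop :=
  ((x, h), (x + 1, h)) ∈ L.zip L.tail

/-- The cell with lower left corner `c` lies (strictly) below the north-east path `L`. -/
def cellBelowPath (L : List (ℤ × ℤ)) (c : ℤ × ℤ) : Prop :=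
  ∃ h, eastStepOf L c.1 h ∧ c.2 < h

/-- The cell with lower left corner `c` lies (weakly) above the north-east path `L`. -/
def cellAbovePath (L : List (ℤ × ℤ)) (c : ℤ × ℤ) : Prop :=
  ∃ h, eastStepOf L c.1 h ∧ h ≤ c.2

/-- The interior points of a path (all points except the two endpoints). -/
def interiorPts (L : List (ℤ × ℤ)) : List (ℤ × ℤ) := (L.drop 1).dropLast

/-- `S1` lies above `S2`. -/
def LiesAbove (S1 S2 : List (ℤ × ℤ)) : Prop :=
  ∀ p ∈ interiorPts S1, ∀ q ∈ interiorPts S2, p.1 = q.1 → q.2 < p.2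

/-- The combinatorial data of a pair of north-east paths with the same endpoints,
the first lying above the second. -/
structure ParallelogramOn (S1 S2 : List (ℤ × ℤ)) : Prop where
  ne1 : IsNEPath S1
  ne2 : IsNEPath S2
  headEq : S1.head? = S2.head?
  lastEq : S1.getLast? = S2.getLast?
  above : LiesAbove S1 S2

/-- The cells of the region bounded above by `S1` and below by `S2`. -/
def parCells (S1 S2 : List (ℤ × ℤ)) : Set (ℤ × ℤ) :=
  {c | cellBelowPath S1 c ∧ cellAbovePath S2 c}

/-- `P` is a parallelogram polyomino. -/
def IsParallelogram (P : Polyomino) : Prop :=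
  ∃ S1 S2 : List (ℤ × ℤ), ParallelogramOn S1 S2 ∧
    (↑P.cells : Set (ℤ × ℤ)) = parCells S1 S2

/-- The data defining a frame polyomino: a rectangle `[(1,1),(m,n)]` and a parallelogram
polyomino determined by `S1, S2` with endpoints `(a0, b0)` and `(ak, bk)`. -/
structure FrameData : Type where
  m : ℤ
  n : ℤ
  S1 : List (ℤ × ℤ)
  S2 : List (ℤ × ℤ)
  a0 : ℤ
  b0 : ℤ
  ak : ℤ
  bk : ℤ
  par : ParallelogramOn S1 S2
  head1 : S1.head? = some (a0, b0)
  last1 : S1.getLast? = some (ak, bk)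
  ha0 : 1 < a0
  hak : a0 < ak
  ham : ak < m
  hb0 : 1 < b0
  hbk : b0 < bk
  hbn : bk < n

/-- The cells of the hole of a frame polyomino. -/
def FrameData.holeCells (D : FrameData) : Set (ℤ × ℤ) := parCells D.S1 D.S2

/-- The cells of the ambient rectangle `[(1,1),(m,n)]`. -/
def FrameData.rectCells (D : FrameData) : Set (ℤ × ℤ) :=
  {c | 1 ≤ c.1 ∧ c.1 + 1 ≤ D.m ∧ 1 ≤ c.2 ∧ c.2 + 1 ≤ D.n}

/-- `P` is the frame polyomino determined by the data `D`. -/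
def IsFrame (P : Polyomino) (D : FrameData) : Prop :=
  (↑P.cells : Set (ℤ × ℤ)) = D.rectCells \ D.holeCells

/-! ## The polyomino ideal -/

/-- The order on the variables: `x_(i,j) > x_(k,l)` iff `j > l`, or `j = l` and `i > k`.
`varlt u v` says that the variable `x_u` is smaller than `x_v`. -/
def varlt (u v : ℤ × ℤ) : Prop := u.2 < v.2 ∨ (u.2 = v.2 ∧ u.1 < v.1)

/-- The vertices of `P`, as a type. -/
abbrev PVertex (P : Polyomino) : Type := {v : ℤ × ℤ // v ∈ P.vertexSet}

/-- The polynomial ring `S_P = K[x_v : v ∈ V(P)]`. -/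
abbrev PolyRing (K : Type) [Field K] (P : Polyomino) : Type := MvPolynomial (PVertex P) K

/-- The set of inner 2-minors of `P`. -/
def innerMinors (K : Type) [Field K] (P : Polyomino) : Set (PolyRing K P) :=
  { f | ∃ a b c d : PVertex P,
      IsInnerInterval P a.1 b.1 ∧ c.1 = (a.1.1, b.1.2) ∧ d.1 = (b.1.1, a.1.2) ∧
      f = MvPolynomial.X a * MvPolynomial.X b - MvPolynomial.X c * MvPolynomial.X d }

/-- The polyomino ideal `I_P`. -/
def polyIdeal (K : Type) [Field K] (P : Polyomino) : Ideal (PolyRing K P) :=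
  Ideal.span (innerMinors K P)

/-- The coordinate ring `K[P] = S_P / I_P`. -/
abbrev CoordRing (K : Type) [Field K] (P : Polyomino) : Type :=
  PolyRing K P ⧸ polyIdeal K P

/-! ## Monomial orders, initial ideals and Gröbner bases -/

/-- The (degree) reverse lexicographic order on monomials induced by the
variable order `vlt`: first compare total degrees; for equal total degrees,
`m₁ < m₂` iff the smallest variable whose exponents differ has a larger exponent in `m₁`. -/
def revlexLT {α : Type} (vlt : α → α → Prop) (m₁ m₂ : α →₀ ℕ) : Prop :=
  (m₁.sum fun _ e => e) < (m₂.sum fun _ e => e) ∨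
  ((m₁.sum fun _ e => e) = (m₂.sum fun _ e => e) ∧
    ∃ v, m₂ v < m₁ v ∧ ∀ w, vlt w v → m₁ w = m₂ w)

/-- The monomial order `<` on `S_P`. -/
def pmonLT (P : Polyomino) : (PVertex P →₀ ℕ) → (PVertex P →₀ ℕ) → Prop :=
  revlexLT fun u v => varlt u.1 v.1

/-- `m` is the leading monomial of `f` with respect to the monomial order `lt`. -/
def IsLeadMon {α K : Type} [CommSemiring K] (lt : (α →₀ ℕ) → (α →₀ ℕ) → Prop)
    (f : MvPolynomial α K) (m : α →₀ ℕ) : Prop :=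
  m ∈ f.support ∧ ∀ m' ∈ f.support, m' ≠ m → lt m' m

/-- The initial ideal of `I` with respect to the monomial order `lt`: the ideal generated by
the leading monomials of the nonzero elements of `I`. -/
def initialIdeal {α K : Type} [CommSemiring K] (lt : (α →₀ ℕ) → (α →₀ ℕ) → Prop)
    (I : Ideal (MvPolynomial α K)) : Ideal (MvPolynomial α K) :=
  Ideal.span { g | ∃ f ∈ I, f ≠ 0 ∧ ∃ m, IsLeadMon lt f m ∧ g = MvPolynomial.monomial m 1 }

/-- The initial ideal `in_<(I_P)`. -/
def inIdeal (K : Type) [Field K] (P : Polyomino) : Ideal (PolyRing K P) :=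
  initialIdeal (pmonLT P) (polyIdeal K P)

/-- `G` is a Gröbner basis of `I` with respect to `lt`. -/
def IsGroebnerBasis {α K : Type} [CommSemiring K] (lt : (α →₀ ℕ) → (α →₀ ℕ) → Prop)
    (G : Set (MvPolynomial α K)) (I : Ideal (MvPolynomial α K)) : Prop :=
  G ⊆ (I : Set (MvPolynomial α K)) ∧
  initialIdeal lt I =
    Ideal.span { g | ∃ f ∈ G, ∃ m, IsLeadMon lt f m ∧ g = MvPolynomial.monomial m 1 }

/-- `G` is the reduced Gröbner basis of `I` with respect to `lt`: it is a Gröbner basis,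
each element is monic, and no monomial occurring in an element of `G` is divisible by the
leading monomial of a different element of `G`. -/
def IsReducedGroebnerBasis {α K : Type} [CommSemiring K] (lt : (α →₀ ℕ) → (α →₀ ℕ) → Prop)
    (G : Set (MvPolynomial α K)) (I : Ideal (MvPolynomial α K)) : Prop :=
  IsGroebnerBasis lt G I ∧
  (∀ f ∈ G, ∃ m, IsLeadMon lt f m ∧ MvPolynomial.coeff m f = 1) ∧
  (∀ f ∈ G, ∀ m ∈ (f : MvPolynomial α K).support, ∀ f' ∈ G, f' ≠ f →
    ∀ m', IsLeadMon lt f' m' → ¬ m' ≤ m)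

/-! ## The simplicial complex Δ(P) -/

/-- The squarefree exponent vector supported on `W ∩ V(P)`. -/
def expOf (P : Polyomino) (W : Finset (ℤ × ℤ)) : PVertex P →₀ ℕ :=
  ∑ v ∈ P.vertexSet.attach, if v.1 ∈ W then Finsupp.single v 1 else 0

/-- `W` is a face of the simplicial complex `Δ(P)` whose Stanley–Reisner ideal is
`in_<(I_P)`: `W ⊆ V(P)` and the product of the variables indexed by `W` is not in
`in_<(I_P)`. -/
def IsFace (K : Type) [Field K] (P : Polyomino) (W : Finset (ℤ × ℤ)) : Prop :=
  (↑W : Set (ℤ × ℤ)) ⊆ (↑P.vertexSet : Set (ℤ × ℤ)) ∧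
  MvPolynomial.monomial (expOf P W) (1 : K) ∉ inIdeal K P

/-- `W` is a facet (maximal face) of `Δ(P)`. -/
def IsFacet (K : Type) [Field K] (P : Polyomino) (W : Finset (ℤ × ℤ)) : Prop :=
  IsFace K P W ∧ ∀ W' : Finset (ℤ × ℤ), IsFace K P W' → W ⊆ W' → W = W'

/-- `{p, q, r}` is a step of the face `W`, with lower right corner `q`. -/
def IsStep (P : Polyomino) (W : Finset (ℤ × ℤ)) (p q r : ℤ × ℤ) : Prop :=
  p ∈ W ∧ q ∈ W ∧ r ∈ W ∧
  p.2 = q.2 ∧ q.1 = r.1 ∧ p.1 < q.1 ∧ q.2 < r.2 ∧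
  (∀ w ∈ W, w.2 = p.2 → p.1 < w.1 → w.1 < q.1 → False) ∧
  (∀ w ∈ W, w.1 = q.1 → q.2 < w.2 → w.2 < r.2 → False) ∧
  (q.1 - 1, q.2) ∈ P.cells

/-- The number of steps of a face `W`. -/
def stepCount (P : Polyomino) (W : Finset (ℤ × ℤ)) : ℕ :=
  Set.ncard { t : (ℤ × ℤ) × (ℤ × ℤ) × (ℤ × ℤ) | IsStep P W t.1 t.2.1 t.2.2 }

/-- The simplicial complex generated by a collection of subsets. -/
def genComplex (F : Set (Finset (ℤ × ℤ))) : Set (Finset (ℤ × ℤ)) :=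
  { W | ∃ G ∈ F, W ⊆ G }

/-- The lexicographic order on facets: `flexLT F G` iff, listing the elements of `F` and `G`
in decreasing order with respect to the total order on `V(P)`, at the first position where
the lists differ the element of `F` is greater.  Equivalently, the largest element of the
symmetric difference belongs to `F`. -/
def flexLT (F G : Finset (ℤ × ℤ)) : Prop :=
  ∃ v, v ∈ F ∧ v ∉ G ∧ ∀ w, varlt v w → (w ∈ F ↔ w ∈ G)

/-- The facet `F₀` of `Δ(P)`. -/
def FrameData.F0 (D : FrameData) : Finset (ℤ × ℤ) :=
  Finset.Icc ((1 : ℤ), (1 : ℤ)) (1, D.n) ∪ Finset.Icc ((1 : ℤ), D.n) (D.m, D.n) ∪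
    (D.S2.toFinset \ {(D.a0, D.b0), (D.ak, D.bk)})

/-! ## Edge intervals -/

/-- The horizontal unit edge from `(x, y)` to `(x + 1, y)` is an edge of a cell of `P`. -/
def hEdge (P : Polyomino) (x y : ℤ) : Prop :=
  (x, y) ∈ P.cells ∨ (x, y - 1) ∈ P.cells

/-- The vertical unit edge from `(x, y)` to `(x, y + 1)` is an edge of a cell of `P`. -/
def vEdge (P : Polyomino) (x y : ℤ) : Prop :=
  (x, y) ∈ P.cells ∨ (x - 1, y) ∈ P.cells

/-- `[(i, j), (k, j)]` is a maximal horizontal edge interval of `P`. -/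
def IsMaxHEdgeInterval (P : Polyomino) (i k j : ℤ) : Prop :=
  i < k ∧ (∀ l, i ≤ l → l < k → hEdge P l j) ∧ ¬ hEdge P (i - 1) j ∧ ¬ hEdge P k j

/-- `[(x, j), (x, l)]` is a maximal vertical edge interval of `P`. -/
def IsMaxVEdgeInterval (P : Polyomino) (x j l : ℤ) : Prop :=
  j < l ∧ (∀ y, j ≤ y → y < l → vEdge P x y) ∧ ¬ vEdge P x (j - 1) ∧ ¬ vEdge P x l

/-- The vertex set of the collection of cells of `P` contained in the interval `[a, b]`. -/
def boxVertexSet (P : Polyomino) (a b : ℤ × ℤ) : Set (ℤ × ℤ) :=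
  { v | ∃ c ∈ P.cells, cellInInterval a b c ∧ v ∈ cellVertices c }

/-! ## Rook configurations -/

/-- Two (distinct) cells of `P` are in attacking position: they belong to the same row or
the same column of cells of `P`. -/
def attacking (P : Polyomino) (c d : ℤ × ℤ) : Prop :=
  c ≠ d ∧
  ((c.2 = d.2 ∧ ∀ x, min c.1 d.1 ≤ x → x ≤ max c.1 d.1 → (x, c.2) ∈ P.cells) ∨
   (c.1 = d.1 ∧ ∀ y, min c.2 d.2 ≤ y → y ≤ max c.2 d.2 → (c.1, y) ∈ P.cells))

/-- `R` is a configuration of pairwise non-attacking rooks placed on cells of `P`. -/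
def IsRookConfig (P : Polyomino) (R : Finset (ℤ × ℤ)) : Prop :=
  (↑R : Set (ℤ × ℤ)) ⊆ (↑P.cells : Set (ℤ × ℤ)) ∧ ∀ c ∈ R, ∀ d ∈ R, ¬ attacking P c d

/-- Two cells are the diagonal cells of an inner interval of `P`. -/
def diagPair (P : Polyomino) (c d : ℤ × ℤ) : Prop :=
  ∃ a b : ℤ × ℤ, IsInnerInterval P a b ∧
    ((c = a ∧ d = (b.1 - 1, b.2 - 1)) ∨ (d = a ∧ c = (b.1 - 1, b.2 - 1)))

/-- Two cells are the anti-diagonal cells of an inner interval of `P`. -/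
def antiDiagPair (P : Polyomino) (c d : ℤ × ℤ) : Prop :=
  ∃ a b : ℤ × ℤ, IsInnerInterval P a b ∧
    ((c = (a.1, b.2 - 1) ∧ d = (b.1 - 1, a.2)) ∨ (d = (a.1, b.2 - 1) ∧ c = (b.1 - 1, a.2)))

/-- One switch: replace two rooks placed on the diagonal cells of an inner interval by rooks
on its anti-diagonal cells, or vice versa. -/
def switchStep (P : Polyomino) (R R' : Finset (ℤ × ℤ)) : Prop :=
  ∃ a b : ℤ × ℤ, IsInnerInterval P a b ∧
    ((a ∈ R ∧ (b.1 - 1, b.2 - 1) ∈ R ∧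
      R' = insert (a.1, b.2 - 1) (insert (b.1 - 1, a.2)
        ((R.erase a).erase (b.1 - 1, b.2 - 1)))) ∨
     ((a.1, b.2 - 1) ∈ R ∧ (b.1 - 1, a.2) ∈ R ∧
      R' = insert a (insert (b.1 - 1, b.2 - 1)
        ((R.erase (a.1, b.2 - 1)).erase (b.1 - 1, a.2)))))

/-- A canonical configuration: no two rooks are in anti-diagonal position. -/
def IsCanonical (P : Polyomino) (R : Finset (ℤ × ℤ)) : Prop :=
  ∀ c ∈ R, ∀ d ∈ R, ¬ antiDiagPair P c d

/-- The `k`-rook configurations of `P`, as a type. -/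
def RookConfigType (P : Polyomino) (k : ℕ) : Type :=
  { R : Finset (ℤ × ℤ) // IsRookConfig P R ∧ R.card = k }

/-- `r̃_k`: the number of equivalence classes of `k`-rook configurations of `P` under the
equivalence generated by switches. -/
def rtil (P : Polyomino) (k : ℕ) : ℕ :=
  Nat.card (Quot fun R S : RookConfigType P k => switchStep P R.1 S.1)

/-- The rook number of `P`: the maximum number of pairwise non-attacking rooks in `P`. -/
def rookNumber (P : Polyomino) : ℕ :=
  sSup { k | ∃ R : Finset (ℤ × ℤ), IsRookConfig P R ∧ R.card = k }

/-! ## Hilbert functions -/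

/-- The Hilbert function of the standard graded algebra `K[P]`. -/
def hilbertFunction (K : Type) [Field K] (P : Polyomino) (k : ℕ) : ℕ :=
  Module.finrank K
    (Submodule.map (Ideal.Quotient.mkₐ K (polyIdeal K P)).toLinearMap
      (MvPolynomial.homogeneousSubmodule (PVertex P) K k))

/-- The Hilbert–Poincaré series of `K[P]`, as a power series over `ℤ`. -/
def hilbertSeries (K : Type) [Field K] (P : Polyomino) : PowerSeries ℤ :=
  PowerSeries.mk fun k => (hilbertFunction K P k : ℤ)

set_option synthInstance.maxHeartbeats 1000000 in
/-- `K[P]` is Cohen–Macaulay: there exists a regular sequence, consisting of elements of the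
irrelevant maximal ideal, whose length equals the Krull dimension of `K[P]`. -/
def IsCMCoordRing (K : Type) [Field K] (P : Polyomino) : Prop :=
  ∃ rs : List (CoordRing K P),
    RingTheory.Sequence.IsRegular (CoordRing K P) rs ∧
    (∀ r ∈ rs, r ∈ Ideal.map (Ideal.Quotient.mk (polyIdeal K P))
      (Ideal.span (Set.range (MvPolynomial.X : PVertex P → PolyRing K P)))) ∧
    (rs.length : WithBot (WithTop ℕ)) = ringKrullDim (CoordRing K P)

/-! ## Maximal chains and descents (for parallelogram polyominoes) -/

/-- `C` is a maximal chain of the poset `V(P)` (with the componentwise order). -/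
def IsMaximalChainOn (P : Polyomino) (C : Finset (ℤ × ℤ)) : Prop :=
  (↑C : Set (ℤ × ℤ)) ⊆ (↑P.vertexSet : Set (ℤ × ℤ)) ∧
  IsChain (· ≤ ·) (↑C : Set (ℤ × ℤ)) ∧
  ∀ C' : Finset (ℤ × ℤ), (↑C' : Set (ℤ × ℤ)) ⊆ (↑P.vertexSet : Set (ℤ × ℤ)) →
    IsChain (· ≤ ·) (↑C' : Set (ℤ × ℤ)) → C ⊆ C' → C = C'

/-- The chain `C` has a descent at the cell of `P` with lower left corner `c`. -/
def descentAt (P : Polyomino) (C : Finset (ℤ × ℤ)) (c : ℤ × ℤ) : Prop :=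
  c ∈ P.cells ∧ c ∈ C ∧ (c.1 + 1, c.2) ∈ C ∧ (c.1 + 1, c.2 + 1) ∈ C

/-- The number of descents of the chain `C`. -/
def descentCount (P : Polyomino) (C : Finset (ℤ × ℤ)) : ℕ :=
  Set.ncard { c : ℤ × ℤ | descentAt P C c }

/-! ## Minimal graded free resolutions and Castelnuovo–Mumford regularity -/

/-- A finite minimal graded free resolution of `S_P / I` over `S_P`:
`F_d = ⊕_{i} S_P(-tw d i)` with `F_0 = S_P`, differentials given by matrices of homogeneous
polynomials of the appropriate degrees with entries in the irrelevant maximal ideal,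
exact away from homological degree `0` and with image `I` in homological degree `0`. -/
structure MinimalGradedFreeResolution (K : Type) [Field K] (P : Polyomino)
    (I : Ideal (PolyRing K P)) : Type where
  len : ℕ
  t : ℕ → ℕ
  tw : (d : ℕ) → Fin (t d) → ℤ
  mat : (d : ℕ) → Matrix (Fin (t d)) (Fin (t (d + 1))) (PolyRing K P)
  t0 : t 0 = 1
  tw0 : ∀ i, tw 0 i = 0
  finite : ∀ d, len < d → t d = 0
  graded : ∀ d i j, mat d i j = 0 ∨
    ∃ e : ℕ, (e : ℤ) = tw (d + 1) j - tw d i ∧ (mat d i j).IsHomogeneous e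
  minimal : ∀ d i j, MvPolynomial.coeff 0 (mat d i j) = 0
  aug : LinearMap.range (mat 0).mulVecLin =
    Submodule.pi Set.univ (fun _ : Fin (t 0) => I)
  isexact : ∀ d, LinearMap.range (mat (d + 1)).mulVecLin = LinearMap.ker (mat d).mulVecLin

end

/-! ## Independence-type polynomials of flag complexes -/

namespace FrameAux
open Finset

open Classical in
/-- Generating function of the subsets of `V` whose distinct elements are pairwise related. -/
noncomputable def Z {α R : Type} [CommRing R] (r : α → α → Prop) (s : R) (V : Finset α) : R :=
  ∑ W ∈ V.powerset.filter (fun W : Finset α => (W : Set α).Pairwise r), s ^ W.card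

theorem Z_insert {α R : Type} [DecidableEq α] [CommRing R] (r : α → α → Prop) (hr : ∀ a b, r a b → r b a)
    (s : R) (V L V' : Finset α) (v : α) (hv : v ∉ V) (hV : ∀ w, w ∈ V' ↔ w = v ∨ w ∈ V)
    (hL : ∀ w, w ∈ L ↔ w ∈ V ∧ r v w) :
    Z r s V' = Z r s V + s * Z r s L := by
  classical
  have e1 : V' = insert v V := by ext w; simp [hV]
  have e2 : L = V.filter (fun w => r v w) := by ext w; simp [hL]
  subst e1 e2
  unfold Z
  rw [Finset.sum_filter, Finset.sum_powerset_insert hv, Finset.sum_filter, Finset.sum_filter]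
  congr 1
  have hsub : (V.filter (fun w => r v w)).powerset ⊆ V.powerset :=
    Finset.powerset_mono.2 (Finset.filter_subset _ _)
  rw [Finset.mul_sum, ← Finset.sum_subset hsub]
  · apply Finset.sum_congr rfl
    intro W hW
    rw [Finset.mem_powerset] at hW
    have hvW : v ∉ W := fun h => hv (Finset.mem_filter.1 (hW h)).1
    have : ((insert v W : Finset α) : Set α).Pairwise r ↔ (W : Set α).Pairwise r := by
      rw [Finset.coe_insert]
      constructor
      · exact fun h => h.mono (Set.subset_insert _ _)
      · intro h
        refine h.insert ?_
        intro b hb _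
        have := (Finset.mem_filter.1 (hW hb)).2
        exact ⟨this, hr _ _ this⟩
    rw [Finset.card_insert_of_notMem hvW, pow_succ]
    by_cases h : (W : Set α).Pairwise r
    · rw [if_pos (this.2 h), if_pos h]; ring
    · rw [if_neg (fun h' => h (this.1 h')), if_neg h]; ring
  · intro W hW hW'
    rw [Finset.mem_powerset] at hW hW'
    rw [if_neg]
    intro h
    apply hW'
    intro w hw
    rw [Finset.mem_filter]
    refine ⟨hW hw, h ?_ ?_ ?_⟩
    · simp
    · simp [hw]
    · rintro rfl; exact hv (hW hw)

theorem Z_empty {α R : Type} [CommRing R] (r : α → α → Prop) (s : R) :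
    Z r s (∅ : Finset α) = 1 := by
  classical
  unfold Z
  rw [Finset.powerset_empty, Finset.filter_true_of_mem]
  · simp
  · simp

/-- If two relations agree on distinct elements of `V` the polynomials agree. -/
theorem Z_congr {α R : Type} [CommRing R] {r r' : α → α → Prop} (s : R) {V : Finset α}
    (h : ∀ a ∈ V, ∀ b ∈ V, a ≠ b → (r a b ↔ r' a b)) : Z r s V = Z r' s V := by
  classical
  unfold Z
  congr 1
  apply Finset.filter_congr
  intro W hW
  rw [Finset.mem_powerset] at hW
  constructor
  · intro H a ha b hb hab
    exact (h a (hW ha) b (hW hb) hab).1 (H ha hb hab)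
  · intro H a ha b hb hab
    exact (h a (hW ha) b (hW hb) hab).2 (H ha hb hab)

theorem Z_image {α β R : Type} [CommRing R] {r : α → α → Prop}
    {q : β → β → Prop} (s : R) (f : α → β) {V : Finset α} (hf : Set.InjOn f (V : Set α))
    (h : ∀ a ∈ V, ∀ b ∈ V, a ≠ b → (r a b ↔ q (f a) (f b))) (V' : Finset β)
    (hV' : ∀ b, b ∈ V' ↔ ∃ a ∈ V, f a = b) :
    Z q s V' = Z r s V := by
  classical
  have e : V' = V.image f := by ext b; simp [hV']
  subst e
  unfold Z
  symm
  refine Finset.sum_bij (fun W _ => W.image f) ?_ ?_ ?_ ?_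
  · intro W hW
    rw [Finset.mem_filter, Finset.mem_powerset] at hW ⊢
    refine ⟨Finset.image_subset_image hW.1, ?_⟩
    rw [Finset.coe_image]
    rintro _ ⟨a, ha, rfl⟩ _ ⟨b, hb, rfl⟩ hab
    have hab' : a ≠ b := fun e => hab (by rw [e])
    exact (h a (hW.1 ha) b (hW.1 hb) hab').1 (hW.2 ha hb hab')
  · intro W hW W' hW' e
    rw [Finset.mem_filter, Finset.mem_powerset] at hW hW'
    have e' := congrArg (fun S : Finset β => (S : Set β)) e
    simp only [Finset.coe_image] at e'
    have := (hf.image_eq_image_iff (by exact_mod_cast hW.1) (by exact_mod_cast hW'.1)).1 e'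
    exact_mod_cast this
  · intro W hW
    rw [Finset.mem_filter, Finset.mem_powerset] at hW
    obtain ⟨W', hW', rfl⟩ := Finset.subset_image_iff.1 hW.1
    refine ⟨W', ?_, rfl⟩
    rw [Finset.mem_filter, Finset.mem_powerset]
    have hW'' : W' ⊆ V := by exact_mod_cast hW'
    refine ⟨hW'', ?_⟩
    intro a ha b hb hab
    refine (h a (hW'' ha) b (hW'' hb) hab).2 (hW.2 ?_ ?_ (fun e => hab (hf (hW'' ha) (hW'' hb) e)))
    · simpa using ⟨a, ha, rfl⟩
    · simpa using ⟨b, hb, rfl⟩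
  · intro W hW
    rw [Finset.mem_filter, Finset.mem_powerset] at hW
    rw [Finset.card_image_of_injOn (hf.mono (by exact_mod_cast hW.1))]

/-- A pair of points of the plane. -/
abbrev Pt := ℤ × ℤ

/-- The key identity between a set of vertices and a set of cells. -/
def Good {R : Type} [CommRing R] (s t : R) (r q : Pt → Pt → Prop) (V C : Finset Pt) (d : ℕ) :
    Prop :=
  (1 - t) ^ d * Z r s V = Z q t C

section
variable {R : Type} [CommRing R] {s t : R} {r q : Pt → Pt → Prop}

/-- Predicate version of `Good`. -/
def GP (s t : R) (r q : Pt → Pt → Prop) (V C : ℤ → ℤ → Prop) (d : ℤ) : Prop :=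
  ∃ (V' C' : Finset Pt) (n : ℕ), (∀ x y, (x, y) ∈ V' ↔ V x y) ∧ (∀ x y, (x, y) ∈ C' ↔ C x y) ∧
    (n : ℤ) = d ∧ Good s t r q V' C' n

variable {V C V₁ C₁ W D : ℤ → ℤ → Prop} {d d₁ : ℤ}

theorem GP.ext (H : GP s t r q V C d) (hV : ∀ x y, V x y ↔ V₁ x y) (hC : ∀ x y, C x y ↔ C₁ x y)
    (hd : d = d₁) : GP s t r q V₁ C₁ d₁ := by
  obtain ⟨V', C', n, h1, h2, h3, h4⟩ := H
  exact ⟨V', C', n, fun x y => (h1 x y).trans (hV x y), fun x y => (h2 x y).trans (hC x y),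
    h3.trans hd, h4⟩

theorem GP.congr {r' q' : Pt → Pt → Prop} (H : GP s t r q V C d)
    (h : ∀ x y x' y', V x y → V x' y' → (x, y) ≠ (x', y') →
      (r (x, y) (x', y') ↔ r' (x, y) (x', y')))
    (h' : ∀ x y x' y', C x y → C x' y' → (x, y) ≠ (x', y') →
      (q (x, y) (x', y') ↔ q' (x, y) (x', y'))) :
    GP s t r' q' V C d := by
  obtain ⟨V', C', n, h1, h2, h3, h4⟩ := H
  refine ⟨V', C', n, h1, h2, h3, ?_⟩
  unfold Good at *
  rw [← Z_congr (r := r) (r' := r') s, ← Z_congr (r := q) (r' := q') t, h4]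
  · rintro ⟨x, y⟩ ha ⟨x', y'⟩ hb hab
    exact h' x y x' y' ((h2 _ _).1 ha) ((h2 _ _).1 hb) hab
  · rintro ⟨x, y⟩ ha ⟨x', y'⟩ hb hab
    exact h x y x' y' ((h1 _ _).1 ha) ((h1 _ _).1 hb) hab

theorem GP.empty : GP s t r q (fun _ _ => False) (fun _ _ => False) 0 := by
  refine ⟨∅, ∅, 0, by simp, by simp, by simp, ?_⟩
  unfold Good
  rw [Z_empty, Z_empty]; simp

/-- Adding a cone vertex. -/
theorem GP.cone1 (hst : (1 - t) * (1 + s) = 1) (hr : ∀ a b, r a b → r b a)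
    (H : GP s t r q V C d) (a b : ℤ) (hv : ¬ V a b)
    (h : ∀ x y, V x y → r (a, b) (x, y)) :
    GP s t r q (fun x y => (x = a ∧ y = b) ∨ V x y) C (d + 1) := by
  obtain ⟨V', C', n, h1, h2, h3, h4⟩ := H
  refine ⟨insert (a, b) V', C', n + 1, ?_, h2, by push_cast; omega, ?_⟩
  · intro x y; simp [h1]
  unfold Good at *
  rw [Z_insert r hr s V' V' (insert (a, b) V') (a, b) (by simpa [h1] using hv) (by simp), ← h4]
  · have : (1 - t) ^ (n + 1) * (Z r s V' + s * Z r s V')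
      = ((1 - t) * (1 + s)) * ((1 - t) ^ n * Z r s V') := by ring
    rw [this, hst, one_mul]
  · rintro ⟨x, y⟩
    exact ⟨fun hw => ⟨hw, h _ _ ((h1 _ _).1 hw)⟩, fun hw => hw.1⟩

/-- Adding a vertical segment of cone vertices. -/
theorem GP.coneSeg (hst : (1 - t) * (1 + s) = 1) (hr : ∀ a b, r a b → r b a)
    (H : GP s t r q V C d) (a lo hi : ℤ) (hlh : lo ≤ hi)
    (hv : ∀ y, lo < y → y ≤ hi → ¬ V a y)
    (hrX : ∀ y y', r (a, y) (a, y'))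
    (h : ∀ x y y', V x y → lo < y' → y' ≤ hi → r (a, y') (x, y)) :
    GP s t r q (fun x y => (x = a ∧ lo < y ∧ y ≤ hi) ∨ V x y) C (d + (hi - lo)) := by
  obtain ⟨n, hn⟩ := Int.le.dest hlh
  induction n generalizing hi with
  | zero =>
    refine H.ext ?_ (fun _ _ => Iff.rfl) (by omega)
    intro x y
    constructor
    · exact Or.inr
    · rintro (h | h)
      · omega
      · exact h
  | succ n ih =>
    have := (ih (hi - 1) (by omega) (fun y h1 h2 => hv y h1 (by omega))
      (fun x y y' h1 h2 h3 => h x y y' h1 h2 (by omega)) (by omega)).cone1 hst hr a hi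
      (by rintro (h | h); · omega
          · exact hv hi (by omega) (by omega) h)
      (by rintro x y (⟨rfl, h⟩ | h')
          · exact hrX _ _
          · exact h _ _ _ h' (by omega) le_rfl)
    refine this.ext ?_ (fun _ _ => Iff.rfl) (by omega)
    intro x y
    by_cases hV : V x y
    · simp [hV]
    · simp only [hV, or_false]; omega

/-- Shedding a vertex together with a cell. -/
theorem GP.shed (hst : (1 - t) * (1 + s) = 1) (hr : ∀ a b, r a b → r b a)
    (hq : ∀ a b, q a b → q b a) (H : GP s t r q V C d) (a b a' b' : ℤ)
    (hv : ¬ V a b) (hc : ¬ C a' b')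
    (H' : GP s t r q (fun x y => V x y ∧ r (a, b) (x, y)) (fun x y => C x y ∧ q (a', b') (x, y))
      (d - 1)) :
    GP s t r q (fun x y => (x = a ∧ y = b) ∨ V x y) (fun x y => (x = a' ∧ y = b') ∨ C x y) d := by
  obtain ⟨V', C', n, h1, h2, h3, h4⟩ := H
  obtain ⟨L, M, n', g1, g2, g3, g4⟩ := H'
  refine ⟨insert (a, b) V', insert (a', b') C', n, ?_, ?_, h3, ?_⟩
  · intro x y; simp [h1]
  · intro x y; simp [h2]
  obtain rfl : n = n' + 1 := by omega
  unfold Good at *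
  rw [Z_insert r hr s V' L (insert (a, b) V') (a, b) (by simpa [h1] using hv) (by simp)
    (by rintro ⟨x, y⟩; rw [g1, h1]),
    Z_insert q hq t C' M (insert (a', b') C') (a', b') (by simpa [h2] using hc) (by simp)
    (by rintro ⟨x, y⟩; rw [g2, h2]), ← h4, ← g4]
  have e : (1 - t) * s = t := by linear_combination hst
  have : (1 - t) ^ (n' + 1) * (Z r s V' + s * Z r s L)
    = (1 - t) ^ (n' + 1) * Z r s V' + ((1 - t) * s) * ((1 - t) ^ n' * Z r s L) := by ring
  rw [this, e]

/-- Shedding a column: vertices `(X, y)` for `y0 ≤ y ≤ Y` and cells `(X - 1, y)` for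
`y0 ≤ y < Y`. -/
theorem GP.column (hst : (1 - t) * (1 + s) = 1) (hr : ∀ a b, r a b → r b a)
    (hq : ∀ a b, q a b → q b a) (X y0 Y : ℤ) (hY : y0 ≤ Y)
    (hW : ∀ y, y0 ≤ y → y ≤ Y → ¬ W X y) (hD : ∀ y, y0 ≤ y → y < Y → ¬ D (X - 1) y)
    (hrX : ∀ y y', r (X, y) (X, y'))
    (hqX : ∀ y y', y0 ≤ y → y < Y → y0 ≤ y' → y' < Y → ¬ q (X - 1, y) (X - 1, y'))
    (top : GP s t r q (fun x y => (x = X ∧ y = Y) ∨ W x y) D d)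
    (lk : ∀ y, y0 ≤ y → y < Y →
      GP s t r q (fun x y' => (x = X ∧ y < y' ∧ y' ≤ Y) ∨ (W x y' ∧ r (X, y) (x, y')))
        (fun x y' => D x y' ∧ q (X - 1, y) (x, y')) (d - 1)) :
    GP s t r q (fun x y => (x = X ∧ y0 ≤ y ∧ y ≤ Y) ∨ W x y)
      (fun x y => (x = X - 1 ∧ y0 ≤ y ∧ y < Y) ∨ D x y) d := by
  obtain ⟨n, hn⟩ := Int.le.dest hY
  induction n generalizing y0 with
  | zero =>
    refine top.ext ?_ ?_ rfl
    · intro x y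
      by_cases h : W x y
      · simp [h]
      · simp only [h, or_false]; omega
    · intro x y
      by_cases h : D x y
      · simp [h]
      · simp only [h, or_false, false_iff]; omega
  | succ n ih =>
    have := (ih (y0 + 1) (by omega) (fun y h => hW y (by omega)) (fun y h => hD y (by omega))
      (fun y y' h1 h2 h3 => hqX y y' (by omega) h2 (by omega))
      (fun y h => lk y (by omega)) (by omega)).shed hst hr hq
      X y0 (X - 1) y0 (by rintro (h | h); · omega
                          · exact hW _ (by omega) (by omega) h)
      (by rintro (h | h); · omega
          · exact hD _ (by omega) (by omega) h) ((lk y0 le_rfl (by omega)).ext ?_ ?_ rfl)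
    · refine this.ext ?_ ?_ rfl
      · intro x y
        by_cases h : W x y
        · simp [h]
        · simp only [h, or_false]; omega
      · intro x y
        by_cases h : D x y
        · simp [h]
        · simp only [h, or_false]; omega
    · intro x y
      constructor
      · rintro (⟨rfl, h⟩ | ⟨h, h'⟩)
        · exact ⟨Or.inl ⟨rfl, by omega⟩, hrX _ _⟩
        · exact ⟨Or.inr h, h'⟩
      · rintro ⟨⟨rfl, h⟩ | h, h'⟩
        · exact Or.inl ⟨rfl, by omega⟩
        · exact Or.inr ⟨h, h'⟩
    · intro x y
      constructor
      · rintro ⟨h, h'⟩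
        exact ⟨Or.inr h, h'⟩
      · rintro ⟨⟨rfl, h⟩ | h, h'⟩
        · exact absurd h' (hqX _ _ (by omega) (by omega) (by omega) (by omega))
        · exact ⟨h, h'⟩

/-- Transport along injective maps (given with left inverses on the image). -/
theorem GP.image {r' q' : Pt → Pt → Prop} (H : GP s t r q V C d) (f g : Pt → Pt)
    (hf : ∀ x y x' y', V x y → V x' y' → f (x, y) = f (x', y') → (x, y) = (x', y'))
    (hg : ∀ x y x' y', C x y → C x' y' → g (x, y) = g (x', y') → (x, y) = (x', y'))
    (h : ∀ x y x' y', V x y → V x' y' → (r (x, y) (x', y') ↔ r' (f (x, y)) (f (x', y'))))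
    (h' : ∀ x y x' y', C x y → C x' y' → (q (x, y) (x', y') ↔ q' (g (x, y)) (g (x', y'))))
    (hV : ∀ x y, V₁ x y ↔ ∃ x' y', V x' y' ∧ f (x', y') = (x, y))
    (hC : ∀ x y, C₁ x y ↔ ∃ x' y', C x' y' ∧ g (x', y') = (x, y)) :
    GP s t r' q' V₁ C₁ d := by
  obtain ⟨V', C', n, h1, h2, h3, h4⟩ := H
  refine ⟨V'.image f, C'.image g, n, ?_, ?_, h3, ?_⟩
  · intro x y
    simp [hV, h1]
  · intro x y
    simp [hC, h2]
  · unfold Good at *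
    rw [Z_image (r := r) (V := V') s f _ _ (V'.image f) (by simp),
      Z_image (r := q) (V := C') t g _ _ (C'.image g) (by simp), h4]
    · rintro ⟨x, y⟩ ha ⟨x', y'⟩ hb
      exact hg _ _ _ _ ((h2 _ _).1 ha) ((h2 _ _).1 hb)
    · rintro ⟨x, y⟩ ha ⟨x', y'⟩ hb _
      exact h' _ _ _ _ ((h2 _ _).1 ha) ((h2 _ _).1 hb)
    · rintro ⟨x, y⟩ ha ⟨x', y'⟩ hb
      exact hf _ _ _ _ ((h1 _ _).1 ha) ((h1 _ _).1 hb)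
    · rintro ⟨x, y⟩ ha ⟨x', y'⟩ hb _
      exact h _ _ _ _ ((h1 _ _).1 ha) ((h1 _ _).1 hb)

end
end FrameAux

/-! ## Chain regions -/

namespace FrameAux
open Finset

/-- Weak comparability. -/
def cmp (p p' : Pt) : Prop := (p.1 ≤ p'.1 ∧ p.2 ≤ p'.2) ∨ (p'.1 ≤ p.1 ∧ p'.2 ≤ p.2)

/-- Strict comparability. -/
def scmp (p p' : Pt) : Prop := (p.1 < p'.1 ∧ p.2 < p'.2) ∨ (p'.1 < p.1 ∧ p'.2 < p.2)

theorem cmp_symm (a b : Pt) (h : cmp a b) : cmp b a := Or.symm h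
theorem scmp_symm (a b : Pt) (h : scmp a b) : scmp b a := Or.symm h

section
variable {R : Type} [CommRing R] {s t : R}

theorem phaseA (hst : (1 - t) * (1 + s) = 1) (lo : ℤ → ℤ) (hlo : Monotone lo) (x0 x1 hi : ℤ)
    (h01 : x0 ≤ x1) (hhi : lo x1 ≤ hi) :
    GP s t cmp scmp (fun x y => x0 ≤ x ∧ x ≤ x1 ∧ lo x ≤ y ∧ y ≤ hi)
      (fun x y => x0 ≤ x ∧ x < x1 ∧ lo (x + 1) ≤ y ∧ y < hi) ((x1 - x0) + (hi - lo x0) + 1) := by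
  obtain ⟨n, hn⟩ := Int.le.dest h01
  induction n generalizing x1 hi with
  | zero =>
    obtain rfl : x1 = x0 := by omega
    have := (GP.empty (s := s) (t := t) (r := cmp) (q := scmp)).coneSeg hst cmp_symm x1
      (lo x1 - 1) hi (by omega) (by simp) (by intro y y'; simp only [cmp]; omega) (by simp)
    refine this.ext ?_ ?_ (by omega)
    · intro x y
      simp only [or_false]
      constructor
      · rintro ⟨rfl, h⟩; omega
      · rintro ⟨h1, h2, h3, h4⟩
        obtain rfl : x = x1 := by omega
        omega
    · intro x y
      constructor
      · exact False.elim
      · rintro ⟨h1, h2, h3, h4⟩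
        omega
  | succ n ih =>
    have hl := hlo (show x1 - 1 ≤ x1 by omega)
    have H0 := ih (x1 - 1) hi (by omega) (by omega) (by omega)
    have := GP.column hst cmp_symm scmp_symm x1 (lo x1) hi (by omega)
      (W := fun x y => x0 ≤ x ∧ x ≤ x1 - 1 ∧ lo x ≤ y ∧ y ≤ hi)
      (D := fun x y => x0 ≤ x ∧ x < x1 - 1 ∧ lo (x + 1) ≤ y ∧ y < hi)
      (by intro y _ _ h; omega) (by intro y _ _ h; omega) (by intro y y'; simp only [cmp]; omega)
      (by intro y y' _ _ _ _; simp only [scmp]; omega)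
      (H0.cone1 hst cmp_symm x1 hi (by omega) (by intro x y h; simp only [cmp]; omega))
      (by
        intro y hy hy'
        have H1 := (ih (x1 - 1) y (by omega) (by omega) (by omega)).coneSeg hst cmp_symm x1 y hi
          (by omega) (by intro y _ _ h; omega) (by intro y y'; simp only [cmp]; omega)
          (by intro x y y' h h1 h2; simp only [cmp]; omega)
        refine H1.ext ?_ ?_ (by omega)
        · intro x y'
          simp only [cmp]; omega
        · intro x y'
          simp only [scmp]; omega)
    refine this.ext ?_ ?_ (by omega)
    · intro x y
      by_cases hx : x = x1
      · subst hx; omega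
      · omega
    · intro x y
      by_cases hx : x = x1 - 1
      · subst hx
        rw [show x1 - 1 + 1 = x1 by omega]
        omega
      · omega
end
end FrameAux

/-! ## Frame regions -/

namespace FrameAux
open Finset

/-- The (extended) boundary functions of the hole of a frame. -/
structure Fr where
  f1 : ℤ → ℤ
  f2 : ℤ → ℤ
  a0 : ℤ
  b0 : ℤ
  ak : ℤ
  bk : ℤ
  ha0 : 1 < a0
  hak : a0 < ak
  hb0 : 1 < b0
  hbk : b0 < bk
  m1 : Monotone f1
  m2 : Monotone f2
  f2lo : ∀ x, x ≤ a0 → f2 x = b0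
  f2hi : ∀ x, ak ≤ x → f2 x = bk - 1
  f1lo : ∀ x, x < a0 → f1 x = b0 + 1
  f1hi : ∀ x, ak - 1 ≤ x → f1 x = bk
  gap : ∀ x, f2 x < f1 (x - 1)

namespace Fr
variable (F : Fr)

/-- hole cells -/
def H (x y : ℤ) : Prop := F.a0 ≤ x ∧ x < F.ak ∧ F.f2 x ≤ y ∧ y < F.f1 x
/-- upper vertices -/
def U (p : Pt) : Prop := F.f1 (p.1 - 1) ≤ p.2 ∧ p.1 < F.ak
/-- lower vertices -/
def L (p : Pt) : Prop := p.2 ≤ F.f2 p.1 ∧ F.a0 < p.1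
/-- upper cells -/
def Uc (p : Pt) : Prop := p.1 < F.ak ∧ ((p.1 < F.a0 ∧ F.b0 ≤ p.2) ∨ (F.a0 ≤ p.1 ∧ F.f1 p.1 ≤ p.2))
/-- lower cells -/
def Lc (p : Pt) : Prop := F.a0 ≤ p.1 ∧ ((p.1 < F.ak ∧ p.2 < F.f2 p.1) ∨ (F.ak ≤ p.1 ∧ p.2 < F.bk))
/-- relation on vertices -/
def RV (p p' : Pt) : Prop := cmp p p' ∨ (F.U p ∧ F.L p') ∨ (F.L p ∧ F.U p')
/-- relation on cells -/
def RC (p p' : Pt) : Prop := scmp p p' ∨ (F.Uc p ∧ F.Lc p') ∨ (F.Lc p ∧ F.Uc p')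

theorem RV_symm (a b : Pt) (h : F.RV a b) : F.RV b a := by
  rcases h with h | h | h
  · exact Or.inl (cmp_symm _ _ h)
  · exact Or.inr (Or.inr ⟨h.2, h.1⟩)
  · exact Or.inr (Or.inl ⟨h.2, h.1⟩)

theorem RC_symm (a b : Pt) (h : F.RC a b) : F.RC b a := by
  rcases h with h | h | h
  · exact Or.inl (scmp_symm _ _ h)
  · exact Or.inr (Or.inr ⟨h.2, h.1⟩)
  · exact Or.inr (Or.inl ⟨h.2, h.1⟩)

theorem facts (x : ℤ) : F.f2 x < F.f1 (x - 1) ∧ F.f1 (x - 1) ≤ F.f1 x ∧ F.b0 ≤ F.f2 x ∧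
    F.f2 x ≤ F.bk - 1 ∧ F.b0 + 1 ≤ F.f1 x ∧ F.f1 x ≤ F.bk ∧ F.b0 + 1 ≤ F.f1 (x - 1) ∧
    F.f1 (x - 1) ≤ F.bk ∧ (x ≤ F.a0 → F.f2 x = F.b0) ∧ (F.ak ≤ x → F.f2 x = F.bk - 1) ∧
    (x < F.a0 → F.f1 x = F.b0 + 1) ∧ (x ≤ F.a0 → F.f1 (x - 1) = F.b0 + 1) ∧
    (F.ak - 1 ≤ x → F.f1 x = F.bk) ∧ (F.ak ≤ x → F.f1 (x - 1) = F.bk) ∧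
    (1 < F.a0 ∧ F.a0 < F.ak ∧ 1 < F.b0 ∧ F.b0 < F.bk) := by
  have hb : ∀ x, F.b0 ≤ F.f2 x ∧ F.f2 x ≤ F.bk - 1 ∧ F.b0 + 1 ≤ F.f1 x ∧ F.f1 x ≤ F.bk := by
    intro x
    have e1 := F.f2lo (min x F.a0) (by omega)
    have e2 := F.f2hi (max x F.ak) (by omega)
    have e3 := F.f1lo (min x (F.a0 - 1)) (by omega)
    have e4 := F.f1hi (max x F.ak) (by omega)
    have := F.m2 (show min x F.a0 ≤ x by omega)
    have := F.m2 (show x ≤ max x F.ak by omega)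
    have := F.m1 (show min x (F.a0 - 1) ≤ x by omega)
    have := F.m1 (show x ≤ max x F.ak by omega)
    omega
  have h1 := hb x
  have h2 := hb (x - 1)
  exact ⟨F.gap x, F.m1 (by omega), h1.1, h1.2.1, h1.2.2.1, h1.2.2.2, h2.2.2.1, h2.2.2.2,
    F.f2lo x, F.f2hi x, F.f1lo x, fun h => F.f1lo _ (by omega), F.f1hi x,
    fun h => F.f1hi _ (by omega), F.ha0, F.hak, F.hb0, F.hbk⟩

/-- vertices in phase B -/
def VB (X l Y X0 x y : ℤ) : Prop :=
  (1 ≤ x ∧ x ≤ X ∧ 1 ≤ y ∧ y ≤ l ∧ y ≤ F.f2 x) ∨ (1 ≤ x ∧ x < F.ak ∧ F.f1 (x - 1) ≤ y ∧ y ≤ Y) ∨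
  (x = X0 ∧ F.bk ≤ y ∧ y ≤ Y)
/-- cells in phase B -/
def CB (X l Y x y : ℤ) : Prop :=
  (1 ≤ x ∧ x < X ∧ 1 ≤ y ∧ y < l ∧ y < F.f2 x) ∨ (1 ≤ x ∧ F.Uc (x, y) ∧ y < Y)

section
variable {R : Type} [CommRing R] {s t : R}

set_option maxHeartbeats 4000000 in
theorem phaseB0 (hst : (1 - t) * (1 + s) = 1) (l Y X0 : ℤ) (hl : 1 ≤ l) (hlb : l ≤ F.b0)
    (hY : F.bk ≤ Y)
    (hX0 : F.ak ≤ X0) : GP s t F.RV F.RC (F.VB F.a0 l Y X0) (F.CB F.a0 l Y)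
      (F.ak - 1 + Y - F.b0 + l) := by
  have F0 := F.facts 0
  have hmono : Monotone (fun x => if x ≤ F.a0 then 1 else F.f1 (x - 1) - (F.b0 - l)) := by
    intro x x' h
    have := F.m1 (show x - 1 ≤ x' - 1 by omega)
    have := F.facts x'
    dsimp only
    split_ifs <;> omega
  have HA := phaseA hst _ hmono 1 F.ak (Y - (F.b0 - l)) (by omega)
    (by have := F.facts F.ak
        rw [if_neg (by omega)]; omega)
  have HA := HA.ext (d₁ := F.ak - 1 + Y - F.b0 + l) (fun _ _ => Iff.rfl) (fun _ _ => Iff.rfl)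
    (by rw [if_pos (by omega)]; omega)
  · refine HA.image (fun p => (if p.1 = F.ak then X0 else p.1, if p.2 ≤ l then p.2 else p.2 + (F.b0 - l)))
      (fun p => (p.1, if p.2 < l then p.2 else p.2 + (F.b0 - l))) ?_ ?_ ?_ ?_ ?_ ?_
    · intro x y x' y' h h' e
      simp only [Prod.mk.injEq] at e ⊢
      split_ifs at e <;> omega
    · intro x y x' y' h h' e
      simp only [Prod.mk.injEq] at e ⊢
      split_ifs at e <;> omega
    · intro x y x' y' h h'
      have := F.facts x
      have := F.facts x'
      have := F.facts X0
      simp only [RV, cmp, U, L]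
      split_ifs at * <;> omega
    · intro x y x' y' h h'
      have := F.facts x
      have := F.facts x'
      have := F.facts X0
      simp only [RC, scmp, Uc, Lc]
      rw [show x + 1 - 1 = x by omega] at h
      rw [show x' + 1 - 1 = x' by omega] at h'
      split_ifs at * <;> omega
    · intro x y
      have := F.facts x
      have := F.facts F.ak
      simp only [VB]
      constructor
      · rintro (h | h | h)
        · exact ⟨x, y, by (split_ifs <;> omega), by rw [if_neg (by omega), if_pos (by omega)]⟩
        · refine ⟨x, y - (F.b0 - l), by (split_ifs <;> omega), ?_⟩
          rw [if_neg (by omega), if_neg (by omega)]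
          ext <;> simp
        · refine ⟨F.ak, y - (F.b0 - l), by (split_ifs <;> omega), ?_⟩
          rw [if_pos (by omega), if_neg (by omega)]
          ext <;> simp [h]
      · rintro ⟨x', y', h, e⟩
        simp only [Prod.mk.injEq] at e
        by_cases hx : x' = F.ak
        · subst hx
          split_ifs at * <;> omega
        · rw [if_neg hx] at e
          obtain ⟨rfl, e⟩ := e
          split_ifs at * <;> omega
    · intro x y
      have := F.facts x
      simp only [CB, Uc]
      constructor
      · intro h
        by_cases hy : y < l
        · refine ⟨x, y, ?_, by rw [if_pos hy]⟩
          rw [show x + 1 - 1 = x by omega]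
          split_ifs <;> omega
        · refine ⟨x, y - (F.b0 - l), ?_, ?_⟩
          · rw [show x + 1 - 1 = x by omega]
            split_ifs <;> omega
          · rw [if_neg (by omega)]
            ext <;> simp
      · rintro ⟨x', y', h, e⟩
        simp only [Prod.mk.injEq] at e
        obtain ⟨rfl, e⟩ := e
        rw [show x' + 1 - 1 = x' by omega] at h
        split_ifs at * <;> omega

theorem VB_step (X l Y X0 x y : ℤ) (hX : F.a0 ≤ X - 1) (hl : 1 ≤ l) :
    ((x = X ∧ min l (F.f2 (X - 1)) < y ∧ y ≤ min l (F.f2 X)) ∨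
      ((x = X ∧ 1 ≤ y ∧ y ≤ min l (F.f2 (X - 1))) ∨ F.VB (X - 1) l Y X0 x y)) ↔
      F.VB X l Y X0 x y := by
  have F0 := F.facts X
  have F1 := F.facts (X - 1)
  have hm := F.m2 (show X - 1 ≤ X by omega)
  by_cases hx : x = X
  · subst hx
    simp only [VB, true_and]; omega
  · simp only [VB]; omega

theorem CB_step (X l Y x y : ℤ) (hX : F.a0 ≤ X - 1) :
    ((x = X - 1 ∧ 1 ≤ y ∧ y < min l (F.f2 (X - 1))) ∨ F.CB (X - 1) l Y x y) ↔
      F.CB X l Y x y := by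
  have F0 := F.facts X
  have F1 := F.facts (X - 1)
  by_cases hx : x = X - 1
  · subst hx; simp only [CB, Uc, true_and]; omega
  · simp only [CB, Uc]; omega

end
end Fr
end FrameAux

namespace FrameAux
open Finset
namespace Fr
variable (F : Fr)
section
variable {R : Type} [CommRing R] {s t : R}

theorem VB_key (X l' Y X0 x y y' : ℤ) (hX : F.a0 ≤ X - 1) (hXX : X ≤ X0)
    (h : F.VB (X - 1) l' Y X0 x y) (h1 : min l' (F.f2 (X - 1)) ≤ y') (h2 : y' ≤ F.f2 X) :
    F.RV (X, y') (x, y) := by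
  rcases h with h | h | h
  · have := F.m2 (show x ≤ X - 1 by omega)
    exact Or.inl (Or.inr ⟨by dsimp only; omega, by dsimp only; omega⟩)
  · exact Or.inr (Or.inr ⟨⟨h2, by dsimp only; omega⟩, ⟨h.2.2.1, h.2.1⟩⟩)
  · have := (F.facts X).2.2.2.1
    exact Or.inl (Or.inl ⟨by dsimp only; omega, by dsimp only; omega⟩)

theorem VB_link (X l Y X0 x y y' : ℤ) (hX : F.a0 ≤ X - 1) (hXX : X ≤ X0)
    (h1 : y < min l (F.f2 (X - 1))) :
    F.VB (X - 1) y Y X0 x y' ↔ F.VB (X - 1) l Y X0 x y' ∧ F.RV (X, y) (x, y') := by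
  have hm := F.m2 (show X - 1 ≤ X by omega)
  constructor
  · intro h
    refine ⟨?_, F.VB_key X y Y X0 x y' y hX hXX h (by omega) (by omega)⟩
    rcases h with h | h | h
    · exact Or.inl (by omega)
    · exact Or.inr (Or.inl h)
    · exact Or.inr (Or.inr h)
  · rintro ⟨h | h | h, h'⟩
    · refine Or.inl ?_
      rcases h' with h' | h' | h'
      · simp only [cmp] at h'; omega
      · have := (F.facts X).1
        have := h'.1.1
        dsimp only at this; omega
      · have := (F.facts x).1
        have := h'.2.1
        dsimp only at this; omega
    · exact Or.inr (Or.inl h)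
    · exact Or.inr (Or.inr h)

theorem CB_link (X l Y x y y' : ℤ) (hX : F.a0 ≤ X - 1)
    (h1 : y < min l (F.f2 (X - 1))) :
    F.CB (X - 1) y Y x y' ↔ F.CB (X - 1) l Y x y' ∧ F.RC (X - 1, y) (x, y') := by
  have F0 := (F.facts (X - 1)).2.2.2.1
  have hLc : F.Lc (X - 1, y) := ⟨hX, by dsimp only; omega⟩
  constructor
  · rintro (h | h)
    · exact ⟨Or.inl (by omega), Or.inl (Or.inr ⟨by dsimp only; omega, by dsimp only; omega⟩)⟩
    · exact ⟨Or.inr h, Or.inr (Or.inr ⟨hLc, h.2.1⟩)⟩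
  · rintro ⟨h | h, h'⟩
    · refine Or.inl ?_
      rcases h' with h' | h' | h'
      · simp only [scmp] at h'; omega
      · have h4 := h'.1
        have := F.facts (X - 1)
        simp only [Uc] at h4
        omega
      · have h4 := h'.2
        have := F.facts x
        simp only [Uc] at h4
        omega
    · exact Or.inr h

set_option maxHeartbeats 4000000 in
theorem phaseB (hst : (1 - t) * (1 + s) = 1) (X l Y X0 : ℤ) (hX : F.a0 ≤ X) (hl : 1 ≤ l)
    (hY : F.bk ≤ Y)
    (hX0 : F.ak ≤ X0) (hXX : X ≤ X0) : GP s t F.RV F.RC (F.VB X l Y X0) (F.CB X l Y)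
      (F.ak - 1 + Y - F.b0 + (X - F.a0) + min l (F.f2 X)) := by
  obtain ⟨n, hn⟩ := Int.le.dest hX
  induction n generalizing X l with
  | zero =>
    obtain rfl : X = F.a0 := by omega
    have F0 := F.facts F.a0
    refine (F.phaseB0 hst (min l F.b0) Y X0 (by omega) (by omega) hY hX0).ext ?_ ?_ (by omega)
    · intro x y
      have := F.facts x
      simp only [VB]; omega
    · intro x y
      have := F.facts x
      simp only [CB, Uc]; omega
  | succ n ih =>
    have F0 := F.facts X
    have F1 := F.facts (X - 1)
    have hm := F.m2 (show X - 1 ≤ X by omega)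
    have hmx : ∀ x, x ≤ X - 1 → F.f2 x ≤ F.f2 (X - 1) := fun x h => F.m2 h
    have H0 := ih (X - 1) l (by omega) hl (by omega) (by omega)
    have key : ∀ l', ∀ x y y', F.VB (X - 1) l' Y X0 x y → min l' (F.f2 (X - 1)) ≤ y' →
        y' ≤ F.f2 X →
        F.RV (X, y') (x, y) := by
      intro l' x y y' h h1 h2
      exact F.VB_key X l' Y X0 x y y' (by omega) hXX h h1 h2
    have hrX : ∀ y y', F.RV (X, y) (X, y') := by intro y y'; simp only [RV, cmp]; omega
    have H1 := GP.column hst F.RV_symm F.RC_symm X 1 (min l (F.f2 (X - 1))) (by omega)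
      (W := F.VB (X - 1) l Y X0)
      (D := F.CB (X - 1) l Y)
      (by intro y _ _ h; simp only [VB] at h; omega)
      (by intro y _ _ h; simp only [CB, Uc] at h; omega) hrX
      (by intro y y' _ _ _ _; simp only [RC, scmp, Uc, Lc]; omega)
      (H0.cone1 hst F.RV_symm X (min l (F.f2 (X - 1))) (by simp only [VB]; omega)
        (by intro x y h; exact key l x y _ h le_rfl (by omega)))
      (by
        intro y hy hy'
        have H1 := (ih (X - 1) y (by omega) (by omega) (by omega) (by omega)).coneSeg hst F.RV_symm X y
          (min l (F.f2 (X - 1)))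
          (by omega) (by intro y _ _ h; simp only [VB] at h; omega) hrX
          (by intro x y y' h h1 h2; exact key _ _ _ _ h (by omega) (by omega))
        refine H1.ext ?_ ?_ (by omega)
        · intro x y'
          rw [F.VB_link X l Y X0 x y y' (by omega) hXX hy']
        · intro x y'
          exact F.CB_link X l Y x y y' (by omega) hy')
    have H2 := H1.coneSeg hst F.RV_symm X (min l (F.f2 (X - 1))) (min l (F.f2 X)) (by omega)
      (by simp only [VB]; omega) hrX (by
        rintro x y y' (h | h) h1 h2
        · rw [h.1]; exact hrX _ _
        · exact key _ _ _ _ h (by omega) (by omega))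
    refine H2.ext ?_ ?_ (by omega)
    · intro x y
      exact F.VB_step X l Y X0 x y (by omega) hl
    · intro x y
      exact F.CB_step X l Y x y (by omega)

end
end Fr
end FrameAux

namespace FrameAux
open Finset
namespace Fr
variable (F : Fr)

/-- all vertices -/
def VC (X Y x y : ℤ) : Prop :=
  1 ≤ x ∧ x ≤ X ∧ 1 ≤ y ∧ y ≤ Y ∧ (y ≤ F.f2 x ∨ F.f1 (x - 1) ≤ y)
/-- all cells -/
def CC (X Y x y : ℤ) : Prop := 1 ≤ x ∧ x < X ∧ 1 ≤ y ∧ y < Y ∧ ¬ F.H x y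

theorem VC_base (Y x y : ℤ) (hY : F.bk ≤ Y) : F.VB F.ak (F.bk - 1) Y F.ak x y ↔ F.VC F.ak Y x y := by
  have := F.facts x
  have := F.facts F.ak
  simp only [VB, VC]
  constructor
  · rintro (h | h | h)
    · omega
    · omega
    · obtain ⟨rfl, h⟩ := h
      omega
  · intro h
    by_cases hx : x = F.ak
    · subst hx; omega
    · omega

theorem CC_base (Y x y : ℤ) (hY : F.bk ≤ Y) : F.CB F.ak (F.bk - 1) Y x y ↔ F.CC F.ak Y x y := by
  have := F.facts x
  simp only [CB, CC, H, Uc]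
  by_cases hx : x < F.a0 <;> omega

theorem VC_link1 (X Y x y y' : ℤ) (hX : F.ak ≤ X) (h1 : F.bk ≤ y) (h2 : y < Y) :
    F.VC X y x y' ↔ F.VC X Y x y' ∧ F.RV (X + 1, y) (x, y') := by
  have := F.facts (X + 1)
  constructor
  · intro h
    simp only [VC] at h ⊢
    exact ⟨by omega, Or.inl (Or.inr ⟨by dsimp only; omega, by dsimp only; omega⟩)⟩
  · rintro ⟨h, h'⟩
    simp only [VC] at h ⊢
    have : y' ≤ y := by
      rcases h' with h' | h' | h'
      · simp only [cmp] at h'; omega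
      · have := h'.1.2
        dsimp only at this; omega
      · have := h'.1.1
        dsimp only at this; omega
    omega

theorem CC_link1 (X Y x y y' : ℤ) (hX : F.ak ≤ X) (h1 : F.bk ≤ y) (h2 : y < Y) :
    F.CC X y x y' ↔ F.CC X Y x y' ∧ F.RC (X, y) (x, y') := by
  have := F.facts X
  constructor
  · intro h
    exact ⟨⟨h.1, h.2.1, h.2.2.1, by have := h.2.2.2.1; omega, h.2.2.2.2⟩,
      Or.inl (Or.inr ⟨h.2.1, h.2.2.2.1⟩)⟩
  · rintro ⟨h, h'⟩
    refine ⟨h.1, h.2.1, h.2.2.1, ?_, h.2.2.2.2⟩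
    have := h.2.1
    rcases h' with h' | h' | h'
    · simp only [scmp] at h'; omega
    · have := h'.1.1
      dsimp only at this; omega
    · have := h'.1
      simp only [Lc] at this; omega

theorem VC_link2 (X Y x y y' : ℤ) (hX : F.ak ≤ X) (h1 : y < F.bk) (h2 : F.bk ≤ Y) :
    ((x = X + 1 ∧ y < y' ∧ y' ≤ F.bk - 1) ∨ F.VB X y Y (X + 1) x y') ↔
    ((x = X + 1 ∧ y < y' ∧ y' ≤ Y) ∨ (F.VC X Y x y' ∧ F.RV (X + 1, y) (x, y'))) := by
  have f := F.facts (X + 1)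
  have fx := F.facts x
  have hL : F.L (X + 1, y) := ⟨by dsimp only; omega, by dsimp only; omega⟩
  constructor
  · rintro (h | h | h | h)
    · exact Or.inl (by omega)
    · exact Or.inr ⟨⟨by omega, by omega, by omega, by omega, by omega⟩,
        Or.inl (Or.inr ⟨by dsimp only; omega, by dsimp only; omega⟩)⟩
    · exact Or.inr ⟨⟨by omega, by omega, by omega, by omega, by omega⟩,
        Or.inr (Or.inr ⟨hL, ⟨h.2.2.1, h.2.1⟩⟩)⟩
    · exact Or.inl (by omega)
  · rintro (h | ⟨h, h'⟩)
    · by_cases hy : y' ≤ F.bk - 1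
      · exact Or.inl (by omega)
      · exact Or.inr (Or.inr (Or.inr (by omega)))
    · right
      simp only [VC] at h
      rcases h' with h' | h' | h'
      · simp only [cmp] at h'
        simp only [VB]
        by_cases hk : x < F.ak <;> omega
      · have := h'.1.2
        dsimp only at this; omega
      · have h3 := h'.2
        simp only [U] at h3
        exact Or.inr (Or.inl (by omega))

theorem CC_link2 (X Y x y y' : ℤ) (hX : F.ak ≤ X) (h1 : y < F.bk) (h2 : F.bk ≤ Y) :
    F.CB X y Y x y' ↔ F.CC X Y x y' ∧ F.RC (X, y) (x, y') := by
  have f := F.facts X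
  have fx := F.facts x
  have hL : F.Lc (X, y) := ⟨by dsimp only; omega, Or.inr ⟨hX, h1⟩⟩
  constructor
  · rintro (h | h)
    · exact ⟨⟨by omega, by omega, by omega, by omega, by simp only [H]; omega⟩,
        Or.inl (Or.inr ⟨by dsimp only; omega, by dsimp only; omega⟩)⟩
    · refine ⟨?_, Or.inr (Or.inr ⟨hL, h.2.1⟩)⟩
      simp only [Uc] at h
      exact ⟨by omega, by omega, by omega, by omega, by simp only [H]; omega⟩
  · rintro ⟨h, h'⟩
    have h4 : y' < y ∨ F.Uc (x, y') := by
      have := h.2.1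
      rcases h' with h' | h' | h'
      · simp only [scmp] at h'; omega
      · have := h'.1.1
        dsimp only at this; omega
      · exact Or.inr h'.2
    by_cases hU : F.Uc (x, y')
    · exact Or.inr ⟨h.1, hU, h.2.2.2.1⟩
    · have h4 := h4.resolve_right hU
      left
      simp only [CC, H] at h
      simp only [Uc] at hU
      omega

theorem VC_step (X Y x y : ℤ) (hX : F.ak ≤ X) (h2 : F.bk ≤ Y) :
    ((x = X + 1 ∧ 1 ≤ y ∧ y ≤ Y) ∨ F.VC X Y x y) ↔ F.VC (X + 1) Y x y := by
  have f := F.facts (X + 1)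
  simp only [VC]
  by_cases hx : x = X + 1
  · subst hx; simp only [true_and]; omega
  · omega

theorem CC_step (X Y x y : ℤ) (hX : F.ak ≤ X) :
    ((x = X ∧ 1 ≤ y ∧ y < Y) ∨ F.CC X Y x y) ↔ F.CC (X + 1) Y x y := by
  have f := F.facts X
  simp only [CC]
  by_cases hx : x = X
  · subst hx
    have : ¬ F.H x y := by simp only [H]; omega
    simp only [this, not_false_eq_true, true_and, and_true]; omega
  · have : x < X + 1 ↔ x < X := by omega
    simp only [this, hx, false_and, false_or]

section
variable {R : Type} [CommRing R] {s t : R}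

theorem phaseC (hst : (1 - t) * (1 + s) = 1) (X Y : ℤ) (hX : F.ak ≤ X) (hY : F.bk ≤ Y) :
    GP s t F.RV F.RC (F.VC X Y) (F.CC X Y)
      (X + Y + (F.ak - F.a0) + (F.bk - F.b0) - 2) := by
  obtain ⟨n, hn⟩ := Int.le.dest hX
  have f0 := F.facts F.ak
  induction n generalizing X Y with
  | zero =>
    obtain rfl : X = F.ak := by omega
    exact (F.phaseB hst F.ak (F.bk - 1) Y F.ak (by omega) (by omega) hY le_rfl le_rfl).ext
      (fun x y => F.VC_base Y x y hY) (fun x y => F.CC_base Y x y hY) (by omega)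
  | succ n ih =>
    obtain ⟨X, rfl⟩ : ∃ X', X = X' + 1 := ⟨X - 1, by omega⟩
    have f1 := F.facts X
    have f2 := F.facts (X + 1)
    have hrX : ∀ y y', F.RV (X + 1, y) (X + 1, y') := by intro y y'; simp only [RV, cmp]; omega
    have hX1 : X + 1 - 1 = X := by omega
    have H1 := GP.column hst F.RV_symm F.RC_symm (X + 1) 1 Y (by omega)
      (W := F.VC X Y)
      (D := F.CC X Y)
      (by intro y _ _ h; simp only [VC] at h; omega)
      (by intro y _ _ h; simp only [CC] at h; omega) hrX
      (by intro y y' _ _ _ _; simp only [RC, scmp, Uc, Lc]; omega)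
      ((ih X Y (by omega) hY (by omega)).cone1 hst F.RV_symm (X + 1) Y (by simp only [VC]; omega)
        (by intro x y h; simp only [VC] at h; exact Or.inl (Or.inr (by dsimp only; omega))))
      (by
        intro y hy hy'
        by_cases hyb : F.bk ≤ y
        · have H1 := (ih X y (by omega) (by omega) (by omega)).coneSeg hst F.RV_symm (X + 1) y Y
            (by omega) (by intro y _ _ h; simp only [VC] at h; omega) hrX
            (by intro x y y' h h1 h2; simp only [VC] at h
                exact Or.inl (Or.inr (by dsimp only; omega)))
          refine H1.ext ?_ ?_ (by omega)
          · intro x y'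
            rw [F.VC_link1 X Y x y y' (by omega) hyb hy']
          · intro x y'
            rw [hX1]
            exact F.CC_link1 X Y x y y' (by omega) hyb hy'
        · have H1 := (F.phaseB hst X y Y (X + 1) (by omega) hy hY (by omega) (by omega)).coneSeg
            hst F.RV_symm (X + 1) y (F.bk - 1)
            (by omega) (by intro y _ _ h; simp only [VB] at h; omega) hrX
            (by
              intro x y1 y' h h1 h2
              have fx := F.facts x
              rcases h with h | h | h
              · exact Or.inl (Or.inr (by dsimp only; omega))
              · exact Or.inr (Or.inr ⟨⟨by dsimp only; omega, by dsimp only; omega⟩,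
                  ⟨h.2.2.1, h.2.1⟩⟩)
              · exact Or.inl (Or.inl (by dsimp only; omega)))
          refine H1.ext ?_ ?_ (by omega)
          · intro x y'
            exact F.VC_link2 X Y x y y' (by omega) (by omega) hY
          · intro x y'
            rw [hX1]
            exact F.CC_link2 X Y x y y' (by omega) (by omega) hY)
    rw [hX1] at H1
    exact H1.ext (fun x y => F.VC_step X Y x y (by omega) hY)
      (fun x y => F.CC_step X Y x y (by omega)) (by omega)

end
end Fr
end FrameAux

/-! ## Boxes without holes -/
namespace FrameAux
open Finset

/-- The cells of the box spanned by the vertices are not in the hole. -/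
def BoxV (Ho : ℤ → ℤ → Prop) (x1 x2 y1 y2 : ℤ) : Prop :=
  ∀ a b, x1 ≤ a → a < x2 → y1 ≤ b → b < y2 → ¬ Ho a b

/-- The cells of the box spanned by the cells are not in the hole. -/
def BoxC (Ho : ℤ → ℤ → Prop) (x1 x2 y1 y2 : ℤ) : Prop :=
  ∀ a b, x1 ≤ a → a ≤ x2 → y1 ≤ b → b ≤ y2 → ¬ Ho a b

/-- reducible pair of vertices -/
def NBv (Ho : ℤ → ℤ → Prop) (p p' : Pt) : Prop :=
  p.1 < p'.1 ∧ p'.2 < p.2 ∧ BoxV Ho p.1 p'.1 p'.2 p.2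

/-- reducible or attacking pair of cells -/
def NBc (Ho : ℤ → ℤ → Prop) (p p' : Pt) : Prop :=
  p.1 ≤ p'.1 ∧ p'.2 ≤ p.2 ∧ p ≠ p' ∧ BoxC Ho p.1 p'.1 p'.2 p.2

/-- relation on vertices -/
def RVh (Ho : ℤ → ℤ → Prop) (p p' : Pt) : Prop := ¬ NBv Ho p p' ∧ ¬ NBv Ho p' p
/-- relation on cells -/
def RCh (Ho : ℤ → ℤ → Prop) (p p' : Pt) : Prop := ¬ NBc Ho p p' ∧ ¬ NBc Ho p' p

/-- The crossing property for a notion of box. -/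
def Cross (Box : ℤ → ℤ → ℤ → ℤ → Prop) : Prop :=
  ∀ x1 x2 x3 y1 y2 y3, Box x1 x2 y2 y3 → Box x2 x3 y1 y2 → Box x2 x3 y2 y3 ∨ Box x1 x2 y1 y2

namespace Fr
variable (F : Fr)

theorem fb (x : ℤ) : F.f2 x < F.f1 (x - 1) ∧ F.f2 x < F.f1 x ∧ F.b0 ≤ F.f2 x ∧
    F.f2 x ≤ F.bk - 1 ∧ F.b0 + 1 ≤ F.f1 x ∧ F.f1 x ≤ F.bk ∧ F.f2 (x + 1) < F.f1 x := by
  have h := F.facts x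
  have := F.gap (x + 1)
  rw [show x + 1 - 1 = x by omega] at this
  exact ⟨h.1, by omega, h.2.2.1, h.2.2.2.1, h.2.2.2.2.1, h.2.2.2.2.2.1, this⟩

theorem crossV : Cross (BoxV F.H) := by
  intro x1 x2 x3 y1 y2 y3 h1 h2
  by_contra hcon
  simp only [BoxV, not_or, not_forall, not_not] at hcon
  obtain ⟨⟨a, b, k1, k2, k3, k4, k5, k6, k7, k8⟩, ⟨a', b', l1, l2, l3, l4, l5, l6, l7, l8⟩⟩ := hcon
  have m1 := F.m2 (show x2 - 1 ≤ a by omega)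
  have m2 := F.m1 (show a' ≤ x2 by omega)
  have f1 := (F.facts (x2 - 1))
  have f2 := (F.facts x2)
  have e1 : F.f1 (x2 - 1) ≤ y2 := by
    by_contra h
    refine h1 (x2 - 1) (max y2 (F.f2 (x2 - 1))) (by omega) (by omega) (by omega) (by omega) ?_
    simp only [H]; omega
  have e2 : y2 ≤ F.f2 x2 := by
    by_contra h
    refine h2 x2 (max y1 (F.f2 x2)) (by omega) (by omega) (by omega) (by omega) ?_
    simp only [H]; omega
  omega

theorem crossC : Cross (BoxC F.H) := by
  intro x1 x2 x3 y1 y2 y3 h1 h2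
  by_contra hcon
  simp only [BoxC, not_or, not_forall, not_not] at hcon
  obtain ⟨⟨a, b, k1, k2, k3, k4, k5, k6, k7, k8⟩, ⟨a', b', l1, l2, l3, l4, l5, l6, l7, l8⟩⟩ := hcon
  have m1 := F.m2 (show x2 ≤ a by omega)
  have m2 := F.m1 (show a' ≤ x2 by omega)
  have f2 := (F.facts x2)
  have e1 : F.f1 x2 ≤ y2 := by
    by_contra h
    refine h1 x2 (max y2 (F.f2 x2)) (by omega) (by omega) (by omega) (by omega) ?_
    simp only [H]; omega
  have e2 : y2 < F.f2 x2 := by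
    by_contra h
    refine h2 x2 (max y1 (F.f2 x2)) (by omega) (by omega) (by omega) (by omega) ?_
    simp only [H]; omega
  omega

theorem boxV_iff {X Y x1 x2 y1 y2 : ℤ} (hu : F.VC X Y x1 y2) (hv : F.VC X Y x2 y1)
    (hx : x1 < x2) (hy : y1 < y2) :
    ¬ BoxV F.H x1 x2 y1 y2 ↔ (F.U (x1, y2) ∧ F.L (x2, y1)) ∨ (F.L (x1, y2) ∧ F.U (x2, y1)) := by
  simp only [VC] at hu hv
  constructor
  · intro h
    simp only [BoxV, not_forall, not_not] at h
    obtain ⟨a, b, k1, k2, k3, k4, k5, k6, k7, k8⟩ := h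
    have m1 := F.m2 (show x1 ≤ a by omega)
    have m2 := F.m1 (show a ≤ x2 - 1 by omega)
    left
    simp only [U, L]; omega
  · rintro (h | h)
    · simp only [U, L] at h
      obtain ⟨a, ⟨a1, a2, a3⟩, amax⟩ := Int.exists_greatest_of_bdd
        (P := fun a => max x1 F.a0 ≤ a ∧ a ≤ min x2 F.ak - 1 ∧ F.f2 a < y2)
        ⟨min x2 F.ak - 1, fun z hz => hz.2.1⟩ ⟨max x1 F.a0, by
          refine ⟨le_rfl, ?_, ?_⟩
          · have := F.hak; omega
          · by_cases hh : x1 < F.a0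
            · have e1 := F.f2lo F.a0 le_rfl
              have e2 := F.f1lo (x1 - 1) (by omega)
              rw [max_eq_right (by omega)]; omega
            · have := F.fb x1
              rw [max_eq_left (by omega)]; omega⟩
      intro hB
      have fa := F.fb a
      refine hB a (max y1 (F.f2 a)) (by omega) (by omega) (by omega) (by omega) ?_
      have : y1 < F.f1 a := by
        by_cases hh : a = min x2 F.ak - 1
        · by_cases h2 : x2 ≤ F.ak
          · obtain rfl : x2 = a + 1 := by omega
            omega
          · have := F.fb x2
            have := F.f1hi a (by omega)
            omega
        · have := amax (a + 1)
          by_contra h3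
          have := this ⟨by omega, by omega, by omega⟩
          omega
      simp only [H]; omega
    · simp only [U, L] at h
      have m1 := F.m1 (show x1 ≤ x2 - 1 by omega)
      have := F.fb x1
      omega

theorem boxC_iff {X Y x1 x2 y1 y2 : ℤ} (hu : F.CC X Y x1 y2) (hv : F.CC X Y x2 y1)
    (hx : x1 ≤ x2) (hy : y1 ≤ y2) :
    ¬ BoxC F.H x1 x2 y1 y2 ↔
      (F.Uc (x1, y2) ∧ F.Lc (x2, y1)) ∨ (F.Lc (x1, y2) ∧ F.Uc (x2, y1)) := by
  simp only [CC, H] at hu hv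
  have fx1 := F.fb x1
  have fx2 := F.fb x2
  constructor
  · intro h
    simp only [BoxC, not_forall, not_not] at h
    obtain ⟨a, b, k1, k2, k3, k4, k5, k6, k7, k8⟩ := h
    have m1 := F.m2 (show x1 ≤ a by omega)
    have m2 := F.m1 (show a ≤ x2 by omega)
    have fa := F.fb a
    left
    simp only [Uc, Lc]; omega
  · rintro (h | h)
    · simp only [Uc, Lc] at h
      obtain ⟨a, ⟨a1, a2, a3⟩, amax⟩ := Int.exists_greatest_of_bdd
        (P := fun a => max x1 F.a0 ≤ a ∧ a ≤ min x2 (F.ak - 1) ∧ F.f2 a ≤ y2)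
        ⟨min x2 (F.ak - 1), fun z hz => hz.2.1⟩ ⟨max x1 F.a0, by
          refine ⟨le_rfl, ?_, ?_⟩
          · have := F.hak; omega
          · by_cases hh : x1 < F.a0
            · have e1 := F.f2lo F.a0 le_rfl
              rw [max_eq_right (by omega)]; omega
            · rw [max_eq_left (by omega)]; omega⟩
      intro hB
      have fa := F.fb a
      refine hB a (max y1 (F.f2 a)) (by omega) (by omega) (by omega) (by omega) ?_
      have : y1 < F.f1 a := by
        by_cases hh : a = min x2 (F.ak - 1)
        · by_cases h2 : x2 < F.ak
          · obtain rfl : x2 = a := by omega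
            omega
          · have := F.f1hi a (by omega)
            omega
        · have := amax (a + 1)
          by_contra h3
          have := this ⟨by omega, by omega, by omega⟩
          omega
      simp only [H]; omega
    · simp only [Uc, Lc] at h
      have m1 := F.m1 (show x1 ≤ x2 by omega)
      omega

theorem RV_iff (X Y x y x' y' : ℤ) (hu : F.VC X Y x y) (hv : F.VC X Y x' y') :
    F.RV (x, y) (x', y') ↔ RVh F.H (x, y) (x', y') := by
  have key : ∀ x1 x2 y1 y2, F.VC X Y x1 y2 → F.VC X Y x2 y1 → x1 < x2 → y1 < y2 →
      (F.RV (x1, y2) (x2, y1) ↔ RVh F.H (x1, y2) (x2, y1)) := by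
    intro x1 x2 y1 y2 hu hv hx hy
    have := F.boxV_iff hu hv hx hy
    have e1 : RVh F.H (x1, y2) (x2, y1) ↔ ¬ BoxV F.H x1 x2 y1 y2 := by
      constructor
      · intro h hb; exact h.1 ⟨hx, hy, hb⟩
      · intro h
        refine ⟨fun hh => h hh.2.2, fun hh => ?_⟩
        have := hh.1; dsimp only at this; omega
    have e2 : ¬ cmp (x1, y2) (x2, y1) := by simp only [cmp]; omega
    rw [e1, this, RV]
    simp only [e2, false_or]
  rcases lt_or_ge x x' with h1 | h1
  · rcases lt_or_ge y' y with h2 | h2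
    · exact key _ _ _ _ hu hv h1 h2
    · refine iff_of_true (Or.inl (by simp only [cmp]; omega)) ?_
      simp only [RVh, NBv]; omega
  · rcases lt_or_ge x' x with h3 | h3
    · rcases lt_or_ge y y' with h2 | h2
      · have := key _ _ _ _ hv hu h3 h2
        have e : RVh F.H (x, y) (x', y') ↔ RVh F.H (x', y') (x, y) := and_comm
        rw [e, ← this]
        exact ⟨F.RV_symm _ _, F.RV_symm _ _⟩
      · refine iff_of_true (Or.inl (by simp only [cmp]; omega)) ?_
        simp only [RVh, NBv]; omega
    · refine iff_of_true (Or.inl (by simp only [cmp]; omega)) ?_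
      simp only [RVh, NBv]; omega

theorem RC_iff (X Y x y x' y' : ℤ) (hu : F.CC X Y x y) (hv : F.CC X Y x' y')
    (hne : (x, y) ≠ (x', y')) :
    F.RC (x, y) (x', y') ↔ RCh F.H (x, y) (x', y') := by
  have key : ∀ x1 x2 y1 y2, F.CC X Y x1 y2 → F.CC X Y x2 y1 → x1 ≤ x2 → y1 ≤ y2 →
      (x1, y2) ≠ (x2, y1) →
      (F.RC (x1, y2) (x2, y1) ↔ RCh F.H (x1, y2) (x2, y1)) := by
    intro x1 x2 y1 y2 hu hv hx hy hne
    have := F.boxC_iff hu hv hx hy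
    have e1 : RCh F.H (x1, y2) (x2, y1) ↔ ¬ BoxC F.H x1 x2 y1 y2 := by
      constructor
      · intro h hb; exact h.1 ⟨hx, hy, hne, hb⟩
      · intro h
        refine ⟨fun hh => h hh.2.2.2, fun hh => ?_⟩
        have h1 := hh.1
        have h2 := hh.2.1
        dsimp only at h1 h2
        exact hne (by rw [Prod.mk.injEq]; omega)
    have e2 : ¬ scmp (x1, y2) (x2, y1) := by simp only [scmp]; omega
    rw [e1, this, RC]
    simp only [e2, false_or]
  by_cases h1 : x ≤ x' ∧ y' ≤ y
  · exact key _ _ _ _ hu hv h1.1 h1.2 hne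
  by_cases h2 : x' ≤ x ∧ y ≤ y'
  · have := key _ _ _ _ hv hu h2.1 h2.2 hne.symm
    have e : RCh F.H (x, y) (x', y') ↔ RCh F.H (x', y') (x, y) := and_comm
    rw [e, ← this]
    exact ⟨F.RC_symm _ _, F.RC_symm _ _⟩
  · refine iff_of_true (Or.inl (by simp only [scmp]; omega)) ?_
    simp only [RCh, NBc]; omega

theorem final {R : Type} [CommRing R] {s t : R} (hst : (1 - t) * (1 + s) = 1) (X Y : ℤ)
    (hX : F.ak ≤ X) (hY : F.bk ≤ Y) :
    GP s t (RVh F.H) (RCh F.H) (F.VC X Y) (F.CC X Y)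
      (X + Y + (F.ak - F.a0) + (F.bk - F.b0) - 2) :=
  (F.phaseC hst X Y hX hY).congr
    (fun x y x' y' h h' _ => F.RV_iff X Y x y x' y' h h')
    (fun x y x' y' h h' hne => F.RC_iff X Y x y x' y' h h' hne)

end Fr

/-- The rectangle. -/
theorem rect_final {R : Type} [CommRing R] {s t : R} (hst : (1 - t) * (1 + s) = 1) (X Y : ℤ)
    (hX : 1 ≤ X) (hY : 1 ≤ Y) :
    GP s t (RVh (fun _ _ => False)) (RCh (fun _ _ => False))
      (fun x y => 1 ≤ x ∧ x ≤ X ∧ 1 ≤ y ∧ y ≤ Y) (fun x y => 1 ≤ x ∧ x < X ∧ 1 ≤ y ∧ y < Y)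
      (X + Y - 1) := by
  have := phaseA hst (fun _ => 1) (fun _ _ _ => le_rfl) 1 X Y hX hY
  refine (this.congr ?_ ?_).ext (fun _ _ => Iff.rfl) (fun _ _ => Iff.rfl) (by omega)
  · intro x y x' y' _ _ _
    simp only [cmp, RVh, NBv, BoxV]
    simp
    omega
  · intro x y x' y' _ _ hne
    rw [ne_eq, Prod.mk.injEq] at hne
    simp only [scmp, RCh, NBc, BoxC]
    simp
    omega

theorem rect_crossV : Cross (BoxV (fun _ _ => False)) := by
  intro x1 x2 x3 y1 y2 y3 _ _
  left
  intro a b _ _ _ _; simp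

theorem rect_crossC : Cross (BoxC (fun _ _ => False)) := by
  intro x1 x2 x3 y1 y2 y3 _ _
  left
  intro a b _ _ _ _; simp
end FrameAux

/-! ## Rewriting of multisets of points -/
namespace FrameAux
open Finset

/-- A notion of box stable under sub-boxes and gluing, with the crossing property. -/
structure BoxSys (Box : ℤ → ℤ → ℤ → ℤ → Prop) : Prop where
  sub : ∀ {x1 x2 y1 y2 x1' x2' y1' y2'}, Box x1 x2 y1 y2 → x1 ≤ x1' → x2' ≤ x2 → y1 ≤ y1' →
    y2' ≤ y2 → Box x1' x2' y1' y2'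
  glueH : ∀ {x1 x2 x3 y1 y2}, Box x1 x2 y1 y2 → Box x2 x3 y1 y2 → Box x1 x3 y1 y2
  glueV : ∀ {x1 x2 y1 y2 y3}, Box x1 x2 y1 y2 → Box x1 x2 y2 y3 → Box x1 x2 y1 y3
  cross : Cross Box

/-- A strictly antidiagonal pair spanning a box. -/
def Rdx (Box : ℤ → ℤ → ℤ → ℤ → Prop) (u v : Pt) : Prop :=
  u.1 < v.1 ∧ v.2 < u.2 ∧ Box u.1 v.1 v.2 u.2

/-- One rewriting step. -/
def Stp (Box : ℤ → ℤ → ℤ → ℤ → Prop) (M M' : Multiset Pt) : Prop :=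
  ∃ (u v : Pt) (N : Multiset Pt), Rdx Box u v ∧ M = u ::ₘ v ::ₘ N ∧
    M' = (u.1, v.2) ::ₘ (v.1, u.2) ::ₘ N

/-- termination measure -/
def mea (M : Multiset Pt) : ℕ := (M.map fun p => ((p.1 - p.2) ^ 2).toNat).sum

theorem Stp.mea_lt {Box} {M M' : Multiset Pt} (h : Stp Box M M') : mea M' < mea M := by
  obtain ⟨u, v, N, ⟨h1, h2, -⟩, rfl, rfl⟩ := h
  simp only [mea, Multiset.map_cons, Multiset.sum_cons]
  have a1 := sq_nonneg (u.1 - u.2)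
  have a2 := sq_nonneg (v.1 - v.2)
  have a3 := sq_nonneg (u.1 - v.2)
  have a4 := sq_nonneg (v.1 - u.2)
  have : (u.1 - v.2)^2 + (v.1-u.2)^2 < (u.1 - u.2)^2 + (v.1-v.2)^2 := by nlinarith
  omega

theorem Stp.card_eq {Box} {M M' : Multiset Pt} (h : Stp Box M M') : M'.card = M.card := by
  obtain ⟨u, v, N, ⟨h1, h2, -⟩, rfl, rfl⟩ := h
  simp

theorem Stp.add {Box} {M M' : Multiset Pt} (h : Stp Box M M') (N : Multiset Pt) :
    Stp Box (M + N) (M' + N) := by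
  obtain ⟨u, v, N', h1, rfl, rfl⟩ := h
  exact ⟨u, v, N' + N, h1, by simp, by simp⟩

/-- two steps from the same multiset are joinable -/
def Jn (Box : ℤ → ℤ → ℤ → ℤ → Prop) (M M' : Multiset Pt) : Prop :=
  Relation.Join (Relation.ReflTransGen (Stp Box)) M M'

theorem Jn.symm {Box} {M M' : Multiset Pt} (h : Jn Box M M') : Jn Box M' M := by
  obtain ⟨N, h1, h2⟩ := h; exact ⟨N, h2, h1⟩

theorem liftadd {Box} {M M' : Multiset Pt} (h : Relation.ReflTransGen (Stp Box) M M')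
    (N : Multiset Pt) : Relation.ReflTransGen (Stp Box) (M + N) (M' + N) := by
  induction h with
  | refl => exact .refl
  | tail _ h ih => exact ih.tail (h.add N)

theorem Jn.cons {Box} {M M' : Multiset Pt} (h : Jn Box M M') (N : Multiset Pt) :
    Jn Box (M + N) (M' + N) := by
  obtain ⟨N', h1, h2⟩ := h
  exact ⟨N' + N, liftadd h1 N,
    liftadd h2 N⟩

theorem stp3 {Box} {u v w : Pt} {M M' : Multiset Pt} (h : Rdx Box u v) (hM : M = {u, v, w})
    (hM' : M' = {(u.1, v.2), (v.1, u.2), w}) : Stp Box M M' :=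
  ⟨u, v, {w}, h, hM, hM'⟩

theorem stp3' {Box} {u v w : Pt} {M M' : Multiset Pt}
    (h : u.1 ≤ v.1 ∧ v.2 ≤ u.2 ∧ Box u.1 v.1 v.2 u.2) (hM : M = {u, v, w})
    (hM' : M' = {(u.1, v.2), (v.1, u.2), w}) : Relation.ReflTransGen (Stp Box) M M' := by
  rcases h.1.eq_or_lt with e | e
  · have : M = M' := by
      rw [hM, hM']
      have e1 : (u.1, v.2) = v := Prod.ext e rfl
      have e2 : (v.1, u.2) = u := Prod.ext e.symm rfl
      rw [e1, e2]; exact Multiset.cons_swap _ _ _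
    rw [this]
  rcases h.2.1.eq_or_lt with e' | e'
  · have : M = M' := by
      rw [hM, hM']
      have e1 : (u.1, v.2) = u := Prod.ext rfl e'
      have e2 : (v.1, u.2) = v := Prod.ext rfl e'.symm
      rw [e1, e2]
    rw [this]
  exact .single (stp3 ⟨e, e', h.2.2⟩ hM hM')

theorem ms_rot (a b c : Pt) : ({a, b, c} : Multiset Pt) = {b, c, a} := by
  rw [show ({a, b, c} : Multiset Pt) = a ::ₘ b ::ₘ c ::ₘ 0 from rfl,
    Multiset.cons_swap a b, Multiset.cons_swap a c]; rfl
theorem ms_sw (a b c : Pt) : ({a, b, c} : Multiset Pt) = {b, a, c} := Multiset.cons_swap _ _ _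
theorem ms_sw2 (a b c : Pt) : ({a, b, c} : Multiset Pt) = {a, c, b} := by
  rw [ms_rot, ms_sw, ms_rot, ms_rot]
theorem ms_sw3 (a b c : Pt) : ({a, b, c} : Multiset Pt) = {c, b, a} := by
  rw [ms_rot, ms_sw]

section
variable {Box : ℤ → ℤ → ℤ → ℤ → Prop} (hB : BoxSys Box)
include hB

theorem jn_ul_aux {u v v' : Pt} (h : Rdx Box u v) (h' : Rdx Box u v') (hx : v.1 ≤ v'.1) :
    Jn Box {(u.1, v.2), (v.1, u.2), v'} {(u.1, v'.2), (v'.1, u.2), v} := by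
  obtain ⟨x, y⟩ := u
  obtain ⟨a, b⟩ := v
  obtain ⟨a', b'⟩ := v'
  simp only [Rdx] at *
  obtain ⟨h1, h2, h3⟩ := h
  obtain ⟨k1, k2, k3⟩ := h'
  by_cases hy : b ≤ b'
  · refine ⟨{(x, b), (a, b'), (a', y)}, ?_, ?_⟩
    · refine stp3' (u := (a, y)) (v := (a', b')) (w := (x, b)) ⟨hx, k2.le, ?_⟩ (ms_rot _ _ _)
        (ms_rot _ _ _)
      exact hB.sub k3 h1.le le_rfl le_rfl le_rfl
    · refine stp3' (u := (x, b')) (v := (a, b)) (w := (a', y)) ⟨h1.le, hy, ?_⟩ (ms_sw2 _ _ _) rfl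
      exact hB.sub h3 le_rfl le_rfl le_rfl k2.le
  · push Not at hy
    refine ⟨_, ?_, .refl⟩
    have s1 : Relation.ReflTransGen (Stp Box) {(x, b), (a, y), (a', b')}
        {(x, b'), (a', b), (a, y)} := by
      refine stp3' (u := (x, b)) (v := (a', b')) (w := (a, y)) ⟨k1.le, hy.le, ?_⟩ (ms_sw2 _ _ _)
        rfl
      exact hB.sub k3 le_rfl le_rfl le_rfl h2.le
    refine s1.trans ?_
    refine stp3' (u := (a, y)) (v := (a', b)) (w := (x, b')) ⟨hx, h2.le, ?_⟩ (ms_sw3 _ _ _)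
      (ms_sw3 _ _ _)
    exact hB.sub k3 h1.le le_rfl hy.le le_rfl

theorem jn_ul {u v v' : Pt} (h : Rdx Box u v) (h' : Rdx Box u v') :
    Jn Box {(u.1, v.2), (v.1, u.2), v'} {(u.1, v'.2), (v'.1, u.2), v} := by
  rcases le_total v.1 v'.1 with hx | hx
  · exact jn_ul_aux hB h h' hx
  · exact (jn_ul_aux hB h' h hx).symm

theorem jn_lr_aux {u u' v : Pt} (h : Rdx Box u v) (h' : Rdx Box u' v) (hx : u.1 ≤ u'.1) :
    Jn Box {(u.1, v.2), (v.1, u.2), u'} {(u'.1, v.2), (v.1, u'.2), u} := by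
  obtain ⟨x, y⟩ := v
  obtain ⟨a, b⟩ := u
  obtain ⟨a', b'⟩ := u'
  simp only [Rdx] at *
  obtain ⟨h1, h2, h3⟩ := h
  obtain ⟨k1, k2, k3⟩ := h'
  by_cases hy : b ≤ b'
  · refine ⟨{(a, y), (a', b), (x, b')}, ?_, ?_⟩
    · refine stp3' (u := (a', b')) (v := (x, b)) (w := (a, y)) ⟨k1.le, hy, ?_⟩ ?_ ?_
      · exact hB.sub k3 le_rfl le_rfl h2.le le_rfl
      · exact ms_sw3 _ _ _
      · exact ms_rot _ _ _
    · refine stp3' (u := (a, b)) (v := (a', y)) (w := (x, b')) ⟨hx, h2.le, ?_⟩ ?_ rfl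
      · exact hB.sub h3 le_rfl k1.le le_rfl le_rfl
      · rw [ms_sw3]; exact ms_sw2 _ _ _
  · push Not at hy
    refine ⟨_, .refl, ?_⟩
    have s1 : Relation.ReflTransGen (Stp Box) {(a', y), (x, b'), (a, b)}
        {(a, b'), (x, b), (a', y)} := by
      refine stp3' (u := (a, b)) (v := (x, b')) (w := (a', y)) ⟨h1.le, hy.le, ?_⟩ (ms_sw3 _ _ _)
        rfl
      exact hB.sub h3 le_rfl le_rfl k2.le le_rfl
    refine s1.trans ?_
    refine stp3' (u := (a, b')) (v := (a', y)) (w := (x, b)) ⟨hx, k2.le, ?_⟩ (ms_sw2 _ _ _)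
      (ms_sw2 _ _ _)
    exact hB.sub h3 le_rfl k1.le le_rfl hy.le

theorem jn_lr {u u' v : Pt} (h : Rdx Box u v) (h' : Rdx Box u' v) :
    Jn Box {(u.1, v.2), (v.1, u.2), u'} {(u'.1, v.2), (v.1, u'.2), u} := by
  rcases le_total u.1 u'.1 with hx | hx
  · exact jn_lr_aux hB h h' hx
  · exact (jn_lr_aux hB h' h hx).symm

theorem jn_chain {u v w : Pt} (h : Rdx Box u v) (h' : Rdx Box v w) :
    Jn Box {(u.1, v.2), (v.1, u.2), w} {(v.1, w.2), (w.1, v.2), u} := by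
  obtain ⟨x1, y3⟩ := u
  obtain ⟨x2, y2⟩ := v
  obtain ⟨x3, y1⟩ := w
  simp only [Rdx] at *
  obtain ⟨h1, h2, h3⟩ := h
  obtain ⟨k1, k2, k3⟩ := h'
  rcases hB.cross _ _ _ _ _ _ h3 k3 with hA | hA
  · refine ⟨{(x2, y1), (x3, y3), (x1, y2)}, ?_, ?_⟩
    · exact .single (stp3 (u := (x2, y3)) (v := (x3, y1)) (w := (x1, y2))
        ⟨k1, k2.trans h2, hB.glueV k3 hA⟩ (ms_rot _ _ _) rfl)
    · exact .single (stp3 (u := (x1, y3)) (v := (x3, y2)) (w := (x2, y1))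
        ⟨h1.trans k1, h2, hB.glueH h3 hA⟩ (ms_sw3 _ _ _) (ms_sw3 _ _ _))
  · refine ⟨{(x1, y1), (x3, y2), (x2, y3)}, ?_, ?_⟩
    · exact .single (stp3 (u := (x1, y2)) (v := (x3, y1)) (w := (x2, y3))
        ⟨h1.trans k1, k2, hB.glueH hA k3⟩ (ms_sw2 _ _ _) rfl)
    · exact .single (stp3 (u := (x1, y3)) (v := (x2, y1)) (w := (x3, y2))
        ⟨h1, k2.trans h2, hB.glueV hA h3⟩ (ms_rot _ _ _).symm (ms_sw2 _ _ _))

theorem stp_local {M M1 M2 : Multiset Pt} (h1 : Stp Box M M1) (h2 : Stp Box M M2) :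
    Jn Box M1 M2 := by
  obtain ⟨u, v, N, r, rfl, rfl⟩ := h1
  obtain ⟨u', v', N', r', e, rfl⟩ := h2
  have key : ∀ (a b c a' b' c' : Pt) (L : Multiset Pt), Jn Box {a, b, c} {a', b', c'} →
      Jn Box (a ::ₘ b ::ₘ c ::ₘ L) (a' ::ₘ b' ::ₘ c' ::ₘ L) := by
    intro a b c a' b' c' L h
    have := h.cons L
    simpa using this
  rcases Multiset.cons_eq_cons.1 e with ⟨rfl, e1⟩ | ⟨hne, cs, e1, e2⟩
  · rcases Multiset.cons_eq_cons.1 e1 with ⟨rfl, rfl⟩ | ⟨hne, cs, rfl, rfl⟩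
    · exact ⟨_, .refl, .refl⟩
    · exact key _ _ _ _ _ _ _ (jn_ul hB r r')
  · -- v :: N = u' :: cs, v' :: N' = u :: cs
    rcases Multiset.cons_eq_cons.1 e1 with ⟨rfl, rfl⟩ | ⟨hne2, cs2, rfl, rfl⟩
    · -- chain : u, v = u', v'
      rcases Multiset.cons_eq_cons.1 e2 with ⟨rfl, rfl⟩ | ⟨hne3, cs3, rfl, rfl⟩
      · have := r.1; have := r'.1; omega
      · exact key _ _ _ _ _ _ _ (jn_chain hB r r')
    · -- N = u' :: cs2, cs = v :: cs2
      rcases Multiset.cons_eq_cons.1 e2 with ⟨rfl, rfl⟩ | ⟨hne3, cs3, rfl, e3⟩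
      · exact key _ _ _ _ _ _ _ (jn_chain hB r' r).symm
      · rcases Multiset.cons_eq_cons.1 e3 with ⟨rfl, rfl⟩ | ⟨hne4, cs4, rfl, rfl⟩
        · exact key _ _ _ _ _ _ _ (jn_lr hB r r')
        · refine ⟨(u.1, v.2) ::ₘ (v.1, u.2) ::ₘ (u'.1, v'.2) ::ₘ (v'.1, u'.2) ::ₘ cs4,
            .single ⟨u', v', (u.1, v.2) ::ₘ (v.1, u.2) ::ₘ cs4, r', ?_, ?_⟩,
            .single ⟨u, v, (u'.1, v'.2) ::ₘ (v'.1, u'.2) ::ₘ cs4, r, ?_, ?_⟩⟩ <;>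
          simp only [← Multiset.singleton_add] <;> abel

theorem stp_confluent {M : Multiset Pt} : ∀ {M1 M2 : Multiset Pt},
    Relation.ReflTransGen (Stp Box) M M1 → Relation.ReflTransGen (Stp Box) M M2 →
    Jn Box M1 M2 := by
  induction hn : mea M using Nat.strong_induction_on generalizing M with
  | _ n ih =>
    intro M1 M2 h1 h2
    rcases Relation.ReflTransGen.cases_head h1 with rfl | ⟨A, a1, a2⟩
    · exact ⟨_, h2, .refl⟩
    rcases Relation.ReflTransGen.cases_head h2 with rfl | ⟨B, b1, b2⟩
    · exact ⟨_, .refl, h1⟩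
    obtain ⟨Q, q1, q2⟩ := stp_local hB a1 b1
    obtain ⟨S, s1, s2⟩ := ih _ (hn ▸ a1.mea_lt) rfl a2 q1
    obtain ⟨T, t1, t2⟩ := ih _ (hn ▸ b1.mea_lt) rfl b2 (q2.trans s2)
    exact ⟨T, s1.trans t2, t1⟩

end

/-- normal multisets -/
def Nrm (Box : ℤ → ℤ → ℤ → ℤ → Prop) (M : Multiset Pt) : Prop := ∀ M', ¬ Stp Box M M'

theorem exists_nf (Box) (M : Multiset Pt) :
    ∃ N, Relation.ReflTransGen (Stp Box) M N ∧ Nrm Box N := by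
  induction hn : mea M using Nat.strong_induction_on generalizing M with
  | _ n ih =>
    by_cases h : Nrm Box M
    · exact ⟨M, .refl, h⟩
    · simp only [Nrm, not_forall, not_not] at h
      obtain ⟨M', h⟩ := h
      obtain ⟨N, n1, n2⟩ := ih _ (hn ▸ h.mea_lt) _ rfl
      exact ⟨N, .head h n1, n2⟩

/-- normal form -/
noncomputable def nf (Box : ℤ → ℤ → ℤ → ℤ → Prop) (M : Multiset Pt) : Multiset Pt :=
  (exists_nf Box M).choose

theorem nf_red (Box) (M : Multiset Pt) : Relation.ReflTransGen (Stp Box) M (nf Box M) :=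
  (exists_nf Box M).choose_spec.1
theorem nf_nrm (Box) (M : Multiset Pt) : Nrm Box (nf Box M) :=
  (exists_nf Box M).choose_spec.2

theorem Nrm.eq_of_red {Box} {M N : Multiset Pt} (h : Nrm Box M)
    (h' : Relation.ReflTransGen (Stp Box) M N) : N = M := by
  rcases Relation.ReflTransGen.cases_head h' with rfl | ⟨A, a1, a2⟩
  · rfl
  · exact absurd a1 (h A)

theorem Nrm.nf_eq {Box} {M : Multiset Pt} (h : Nrm Box M) : nf Box M = M :=
  h.eq_of_red (nf_red Box M)

theorem nf_idem (Box) (M : Multiset Pt) : nf Box (nf Box M) = nf Box M :=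
  (nf_nrm Box M).nf_eq

theorem nf_eq_of_red {Box} (hB : BoxSys Box) {M N : Multiset Pt}
    (h : Relation.ReflTransGen (Stp Box) M N) : nf Box M = nf Box N := by
  obtain ⟨Q, q1, q2⟩ := stp_confluent hB (h.trans (nf_red Box N)) (nf_red Box M)
  rw [← (nf_nrm Box M).eq_of_red q2, (nf_nrm Box N).eq_of_red q1]

theorem nf_card (Box) (M : Multiset Pt) : (nf Box M).card = M.card := by
  have : ∀ N, Relation.ReflTransGen (Stp Box) M N → N.card = M.card := by
    intro N h
    induction h with
    | refl => rfl
    | tail _ h ih => rw [h.card_eq, ih]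
  exact this _ (nf_red Box M)

theorem nrm_iff {Box} {M : Multiset Pt} : Nrm Box M ↔ ∀ u ∈ M, ∀ v ∈ M, ¬ Rdx Box u v := by
  constructor
  · intro h u hu v hv r
    obtain ⟨N, rfl⟩ := Multiset.exists_cons_of_mem hu
    rcases Multiset.mem_cons.1 hv with rfl | hv
    · exact lt_irrefl _ r.1
    obtain ⟨N, rfl⟩ := Multiset.exists_cons_of_mem hv
    exact h _ ⟨u, v, N, r, rfl, rfl⟩
  · rintro h M' ⟨u, v, N, r, rfl, rfl⟩
    exact h u (by simp) v (by simp) r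

theorem boxV_sys {Ho} (h : Cross (BoxV Ho)) : BoxSys (BoxV Ho) where
  sub := fun h _ _ _ _ a b _ _ _ _ => h a b (by omega) (by omega) (by omega) (by omega)
  glueH := by
    intro x1 x2 x3 y1 y2 h h' a b _ _ _ _
    rcases lt_or_ge a x2 with k | k
    · exact h a b (by omega) (by omega) (by omega) (by omega)
    · exact h' a b (by omega) (by omega) (by omega) (by omega)
  glueV := by
    intro x1 x2 y1 y2 y3 h h' a b _ _ _ _
    rcases lt_or_ge b y2 with k | k
    · exact h a b (by omega) (by omega) (by omega) (by omega)
    · exact h' a b (by omega) (by omega) (by omega) (by omega)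
  cross := h

theorem boxC_sys {Ho} (h : Cross (BoxC Ho)) : BoxSys (BoxC Ho) where
  sub := fun h _ _ _ _ a b _ _ _ _ => h a b (by omega) (by omega) (by omega) (by omega)
  glueH := by
    intro x1 x2 x3 y1 y2 h h' a b _ _ _ _
    rcases lt_or_ge a x2 with k | k
    · exact h a b (by omega) (by omega) (by omega) (by omega)
    · exact h' a b (by omega) (by omega) (by omega) (by omega)
  glueV := by
    intro x1 x2 y1 y2 y3 h h' a b _ _ _ _
    rcases lt_or_ge b y2 with k | k
    · exact h a b (by omega) (by omega) (by omega) (by omega)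
    · exact h' a b (by omega) (by omega) (by omega) (by omega)
  cross := h

end FrameAux

/-! ## Quotients by binomial ideals -/
namespace FrameAux
open Finset

section binom
variable {σ K : Type} [Field K] (ν : (σ →₀ ℕ) → (σ →₀ ℕ))

/-- linear extension of the normal form map -/
noncomputable def phi (K : Type) [Field K] : MvPolynomial σ K →ₗ[K] MvPolynomial σ K :=
  (MvPolynomial.basisMonomials σ K).constr K fun m => MvPolynomial.monomial (ν m) 1

theorem phi_mon (m : σ →₀ ℕ) : phi ν K (MvPolynomial.monomial m 1) =
    MvPolynomial.monomial (ν m) 1 := by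
  have := (MvPolynomial.basisMonomials σ K).constr_basis K
    (fun m => MvPolynomial.monomial (ν m) (1 : K)) m
  rwa [MvPolynomial.coe_basisMonomials] at this

theorem phi_ideal (G : Set (MvPolynomial σ K))
    (hG : ∀ g ∈ G, ∃ p q, g = MvPolynomial.monomial p 1 - MvPolynomial.monomial q 1 ∧
      ∀ m, ν (m + p) = ν (m + q)) (x : MvPolynomial σ K) (hx : x ∈ Ideal.span G) :
    phi ν K x = 0 := by
  have key : ∀ r, phi ν K (r * x) = 0 := by
    refine Submodule.span_induction (p := fun x _ => ∀ r, phi ν K (r * x) = 0) ?_ ?_ ?_ ?_ hx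
    · intro g hg r
      obtain ⟨p, q, rfl, hpq⟩ := hG g hg
      induction r using MvPolynomial.induction_on' with
      | monomial u a =>
        have : (MvPolynomial.monomial u a : MvPolynomial σ K) = a • MvPolynomial.monomial u 1 := by
          rw [MvPolynomial.smul_monomial, smul_eq_mul, mul_one]
        rw [this, smul_mul_assoc, map_smul, mul_sub, MvPolynomial.monomial_mul,
          MvPolynomial.monomial_mul, map_sub, mul_one, phi_mon, phi_mon, hpq, sub_self, smul_zero]
      | add p q hp hq => rw [add_mul, map_add, hp, hq, add_zero]
    · intro r; simp
    · intro x y _ _ h1 h2 r; rw [mul_add, map_add, h1, h2, add_zero]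
    · intro a x _ h r; rw [smul_eq_mul, ← mul_assoc]; exact h _
  simpa using key 1

theorem binom_finrank (G : Set (MvPolynomial σ K))
    (hG : ∀ g ∈ G, ∃ p q, g = MvPolynomial.monomial p 1 - MvPolynomial.monomial q 1 ∧
      ∀ m, ν (m + p) = ν (m + q))
    (hI : ∀ m, (MvPolynomial.monomial m 1 - MvPolynomial.monomial (ν m) 1 : MvPolynomial σ K) ∈
      Ideal.span G) (hid : ∀ m, ν (ν m) = ν m)
    (T : Set (σ →₀ ℕ)) (hT : T.Finite) (hTs : ∀ m ∈ T, ν m ∈ T) :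
    Module.finrank K (Submodule.map (Ideal.Quotient.mkₐ K (Ideal.span G)).toLinearMap
      (Submodule.span K ((fun m => (MvPolynomial.monomial m (1 : K))) '' T))) =
    {m | m ∈ T ∧ ν m = m}.ncard := by
  set L := (Ideal.Quotient.mkₐ K (Ideal.span G)).toLinearMap with hL
  have hfin : {m | m ∈ T ∧ ν m = m}.Finite := hT.subset fun m hm => hm.1
  have := hfin.fintype
  let v : {m | m ∈ T ∧ ν m = m} → MvPolynomial σ K := fun m => MvPolynomial.monomial m.1 1
  have hv : LinearIndependent K v := by
    have := (MvPolynomial.basisMonomials σ K).linearIndependent.comp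
      (Subtype.val : {m | m ∈ T ∧ ν m = m} → _) Subtype.val_injective
    rwa [MvPolynomial.coe_basisMonomials] at this
  have hLk : ∀ x, L x = 0 ↔ x ∈ Ideal.span G := fun x => Ideal.Quotient.eq_zero_iff_mem
  have hdis : Disjoint (Submodule.span K (Set.range v)) (LinearMap.ker L) := by
    rw [Submodule.disjoint_def]
    intro x hx hx'
    have h1 : phi ν K x = x := by
      refine Submodule.span_induction (p := fun x _ => phi ν K x = x) ?_ ?_ ?_ ?_ hx
      · rintro _ ⟨m, rfl⟩
        simp only [v]
        rw [phi_mon, m.2.2]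
      · simp
      · intro x y _ _ h1 h2; rw [map_add, h1, h2]
      · intro a x _ h; rw [map_smul, h]
    rw [← h1]
    exact phi_ideal ν G hG x ((hLk x).1 hx')
  have hLv := hv.map hdis
  have heq : Submodule.map L (Submodule.span K ((fun m => (MvPolynomial.monomial m (1 : K))) '' T))
      = Submodule.span K (Set.range (L ∘ v)) := by
    rw [Submodule.map_span]
    congr 1
    ext y
    constructor
    · rintro ⟨_, ⟨m, hm, rfl⟩, rfl⟩
      refine ⟨⟨ν m, hTs m hm, hid m⟩, ?_⟩
      have := (hLk _).2 (hI m)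
      rw [map_sub, sub_eq_zero] at this
      exact this.symm
    · rintro ⟨m, rfl⟩
      exact ⟨_, ⟨m.1, m.2.1, rfl⟩, rfl⟩
  rw [heq, finrank_span_eq_card hLv, ← Nat.card_coe_set_eq, Nat.card_eq_fintype_card]

end binom

end FrameAux

/-! ## The Hilbert series -/
namespace FrameAux
open Finset

/-- the series `X + X^2 + ...` -/
noncomputable def sser : PowerSeries ℤ := PowerSeries.mk fun i => if i = 0 then 0 else 1

theorem sser_eq : (1 - PowerSeries.X : PowerSeries ℤ) * (1 + sser) = 1 := by
  have : (1 + sser : PowerSeries ℤ) = PowerSeries.mk 1 := by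
    ext i
    simp only [sser, map_add, PowerSeries.coeff_mk, PowerSeries.coeff_one, Pi.one_apply]
    split_ifs <;> simp
  rw [this, mul_comm, PowerSeries.mk_one_mul_one_sub_eq_one]

theorem coeff_sser_pow {σ : Type} [DecidableEq σ] (W : Finset σ) (k : ℕ) :
    PowerSeries.coeff k (sser ^ W.card) =
      (((finsuppAntidiag W k).filter fun l => l.support = W).card : ℤ) := by
  rw [← Finset.prod_const, PowerSeries.coeff_prod, Finset.card_filter, Nat.cast_sum]
  apply Finset.sum_congr rfl
  intro l hl
  rw [mem_finsuppAntidiag] at hl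
  simp only [sser, PowerSeries.coeff_mk]
  by_cases h : l.support = W
  · rw [if_pos h, Finset.prod_eq_one]; · simp
    intro i hi
    rw [← h, Finsupp.mem_support_iff] at hi
    simp [hi]
  · rw [if_neg h]
    have : ∃ i ∈ W, l i = 0 := by
      by_contra hc
      push Not at hc
      exact h (hl.2.antisymm fun i hi => Finsupp.mem_support_iff.2 (hc i hi))
    obtain ⟨i, hi, h0⟩ := this
    rw [Finset.prod_eq_zero hi]; · simp
    simp [h0]

theorem coeff_Z {σ : Type} [Fintype σ] (r : σ → σ → Prop) (k : ℕ) :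
    PowerSeries.coeff k (Z r sser (univ : Finset σ)) =
      ({m : σ →₀ ℕ | m.degree = k ∧ (m.support : Set σ).Pairwise r}.ncard : ℤ) := by
  classical
  have e : {m : σ →₀ ℕ | m.degree = k ∧ (m.support : Set σ).Pairwise r} =
      (((finsuppAntidiag univ k).filter fun m : σ →₀ ℕ => (m.support : Set σ).Pairwise r :
        Finset (σ →₀ ℕ)) : Set (σ →₀ ℕ)) := by
    ext m
    simp [Finsupp.degree_eq_sum]
  rw [e, Set.ncard_coe_finset, Z, map_sum]
  simp_rw [coeff_sser_pow]
  rw [← Nat.cast_sum, Nat.cast_inj]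
  rw [Finset.card_eq_sum_card_fiberwise (f := fun m : σ →₀ ℕ => m.support)
    (t := univ.powerset.filter (fun W : Finset σ => (W : Set σ).Pairwise r))]
  · apply Finset.sum_congr rfl
    intro W hW
    congr 1
    ext l
    simp only [mem_filter, mem_finsuppAntidiag', mem_univ, Finset.subset_univ, and_true] at hW ⊢
    constructor
    · rintro ⟨⟨h1, h2⟩, rfl⟩
      exact ⟨⟨h1, hW.2⟩, rfl⟩
    · rintro ⟨⟨h1, h2⟩, rfl⟩
      exact ⟨⟨h1, subset_rfl⟩, rfl⟩
  · intro m hm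
    simp only [coe_filter, Set.mem_ofPred_eq] at hm ⊢
    exact ⟨by simp, hm.2⟩

/-- `P` consists of the cells of a rectangle outside a hole. -/
def FP (P : Polyomino) (m n : ℤ) (Ho : ℤ → ℤ → Prop) : Prop :=
  ∀ x y, (x, y) ∈ P.cells ↔ 1 ≤ x ∧ x < m ∧ 1 ≤ y ∧ y < n ∧ ¬ Ho x y

variable {P : Polyomino} {m n : ℤ} {Ho : ℤ → ℤ → Prop}

theorem mem_vertexSet (x y : ℤ) : (x, y) ∈ P.vertexSet ↔ (x, y) ∈ P.cells ∨ (x - 1, y) ∈ P.cells ∨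
    (x, y - 1) ∈ P.cells ∨ (x - 1, y - 1) ∈ P.cells := by
  simp only [Polyomino.vertexSet, cellVertices, mem_biUnion, mem_insert, mem_singleton]
  constructor
  · rintro ⟨⟨a, b⟩, hc, h⟩
    simp only [Prod.mk.injEq] at h
    rcases h with ⟨rfl, rfl⟩ | ⟨rfl, rfl⟩ | ⟨rfl, rfl⟩ | ⟨rfl, rfl⟩ <;> simp [hc]
  · rintro (h | h | h | h) <;> exact ⟨_, h, by simp⟩

theorem FP.vbd (h : FP P m n Ho) {x y : ℤ} (hv : (x, y) ∈ P.vertexSet) :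
    1 ≤ x ∧ x ≤ m ∧ 1 ≤ y ∧ y ≤ n := by
  rw [mem_vertexSet] at hv
  simp only [h _ _] at hv
  omega

theorem FP.corner (h : FP P m n Ho) {x1 x2 y1 y2 : ℤ} (h1 : 1 ≤ x1) (h2 : x1 < x2) (h3 : x2 ≤ m)
    (h4 : 1 ≤ y1) (h5 : y1 < y2) (h6 : y2 ≤ n) (hb : BoxV Ho x1 x2 y1 y2) :
    (x1, y1) ∈ P.vertexSet ∧ (x2, y2) ∈ P.vertexSet := by
  simp only [mem_vertexSet, h _ _]
  refine ⟨Or.inl ⟨by omega, by omega, by omega, by omega, hb _ _ ?_ ?_ ?_ ?_⟩,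
    Or.inr (Or.inr (Or.inr ⟨by omega, by omega, by omega, by omega, hb _ _ ?_ ?_ ?_ ?_⟩))⟩ <;> omega

theorem FP.inner_iff (h : FP P m n Ho) {a b : Pt} (ha : a ∈ P.vertexSet) (hb : b ∈ P.vertexSet) :
    IsInnerInterval P a b ↔ a.1 < b.1 ∧ a.2 < b.2 ∧ BoxV Ho a.1 b.1 a.2 b.2 := by
  obtain ⟨a1, a2⟩ := a
  obtain ⟨b1, b2⟩ := b
  have va := h.vbd ha
  have vb := h.vbd hb
  simp only [IsInnerInterval, cellInInterval, BoxV, Prod.forall, h _ _]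
  refine and_congr_right fun h1 => and_congr_right fun h2 => forall_congr' fun x =>
    forall_congr' fun y => ?_
  constructor
  · intro k k1 k2 k3 k4
    exact (k ⟨by omega, by omega, by omega, by omega⟩).2.2.2.2
  · rintro k ⟨k1, k2, k3, k4⟩
    exact ⟨by omega, by omega, by omega, by omega, k (by omega) (by omega) (by omega) (by omega)⟩

theorem FP.corner' (h : FP P m n Ho) {u v : Pt} (hu : u ∈ P.vertexSet) (hv : v ∈ P.vertexSet)
    (hb : Rdx (BoxV Ho) u v) : (u.1, v.2) ∈ P.vertexSet ∧ (v.1, u.2) ∈ P.vertexSet := by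
  obtain ⟨a1, a2⟩ := u
  obtain ⟨b1, b2⟩ := v
  have va := h.vbd hu
  have vb := h.vbd hv
  exact h.corner (by omega) hb.1 (by omega) (by omega) hb.2.1 (by omega) hb.2.2

/-- multiset of points of an exponent -/
noncomputable def emb (e : PVertex P →₀ ℕ) : Multiset Pt := (Finsupp.toMultiset e).map Subtype.val

/-- exponent of a multiset of points -/
noncomputable def lft (P : Polyomino) (M : Multiset Pt) : PVertex P →₀ ℕ :=
  Finsupp.equivFunOnFinite.symm fun v => M.count v.1

theorem lft_emb (e : PVertex P →₀ ℕ) : lft P (emb e) = e := by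
  ext v
  simp only [lft, emb, Finsupp.equivFunOnFinite_symm_apply_apply]
  rw [Multiset.count_map_eq_count' _ _ Subtype.val_injective, Finsupp.count_toMultiset]

theorem emb_add (e e' : PVertex P →₀ ℕ) : emb (e + e') = emb e + emb e' := by
  simp [emb]

theorem emb_single (v : PVertex P) : emb (Finsupp.single v 1) = {v.1} := by
  simp [emb]

theorem lft_cons (u : PVertex P) (M : Multiset Pt) :
    lft P (u.1 ::ₘ M) = Finsupp.single u 1 + lft P M := by
  ext v
  simp only [lft, Finsupp.equivFunOnFinite_symm_apply_apply, Finsupp.add_apply, Multiset.count_cons,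
    Finsupp.single_apply, Subtype.ext_iff, eq_comm (a := v.1)]
  omega

theorem emb_lft (M : Multiset Pt) (hM : ∀ p ∈ M, p ∈ P.vertexSet) : emb (lft P M) = M := by
  induction M using Multiset.induction_on with
  | empty =>
    have : lft P 0 = 0 := by ext v; simp [lft]
    rw [this]; simp [emb]
  | cons a s ih =>
    have := lft_cons (P := P) ⟨a, hM a (by simp)⟩ s
    rw [this, emb_add, emb_single, ih fun p hp => hM p (by simp [hp])]
    simp

theorem mem_emb (e : PVertex P →₀ ℕ) : ∀ p ∈ emb e, p ∈ P.vertexSet := by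
  intro p hp
  simp only [emb, Multiset.mem_map] at hp
  obtain ⟨a, -, rfl⟩ := hp
  exact a.2

theorem card_emb (e : PVertex P →₀ ℕ) : (emb e).card = e.degree := by
  simp only [emb, Multiset.card_map, Finsupp.card_toMultiset]; rfl

theorem red_mem (h : FP P m n Ho) (K : Type) [Field K] (e : PVertex P →₀ ℕ) (N : Multiset Pt)
    (hN : Relation.ReflTransGen (Stp (BoxV Ho)) (emb e) N) :
    (∀ p ∈ N, p ∈ P.vertexSet) ∧
    (MvPolynomial.monomial e 1 - MvPolynomial.monomial (lft P N) 1 : MvPolynomial (PVertex P) K) ∈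
      polyIdeal K P := by
  induction hN with
  | refl => exact ⟨mem_emb e, by rw [lft_emb, sub_self]; exact zero_mem _⟩
  | tail _ hs ih =>
    obtain ⟨u, v, N, r, rfl, rfl⟩ := hs
    obtain ⟨i1, i2⟩ := ih
    have hu : u ∈ P.vertexSet := i1 u (by simp)
    have hv : v ∈ P.vertexSet := i1 v (by simp)
    obtain ⟨c1, c2⟩ := h.corner' hu hv r
    constructor
    · intro p hp
      simp only [Multiset.mem_cons] at hp i1
      rcases hp with rfl | rfl | hp
      · exact c1
      · exact c2
      · exact i1 p (by simp [hp])
    · have e1 := lft_cons (P := P) ⟨u, hu⟩ (v ::ₘ N)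
      have e2 := lft_cons (P := P) ⟨v, hv⟩ N
      have e3 := lft_cons (P := P) ⟨_, c1⟩ ((v.1, u.2) ::ₘ N)
      have e4 := lft_cons (P := P) ⟨_, c2⟩ N
      simp only at e1 e2 e3 e4
      rw [e1, e2] at i2
      rw [e3, e4]
      have key : (MvPolynomial.X ⟨_, c1⟩ * MvPolynomial.X ⟨_, c2⟩ -
          MvPolynomial.X ⟨u, hu⟩ * MvPolynomial.X ⟨v, hv⟩ : MvPolynomial (PVertex P) K) ∈
          polyIdeal K P := by
        apply Ideal.subset_span
        refine ⟨⟨_, c1⟩, ⟨_, c2⟩, ⟨u, hu⟩, ⟨v, hv⟩, ?_, rfl, rfl, rfl⟩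
        rw [h.inner_iff c1 c2]
        exact r
      have := Ideal.sub_mem _ i2 (Ideal.mul_mem_left _ (MvPolynomial.monomial (lft P N) 1) key)
      convert this using 1
      simp only [MvPolynomial.X, mul_sub, MvPolynomial.monomial_mul, mul_one]
      have f1 : ∀ a b c : PVertex P →₀ ℕ, a + (b + c) = c + (a + b) := by intros; abel
      rw [f1, f1 _ _ (lft P N)]
      ring

theorem hilb_eq (h : FP P m n Ho) (hc : Cross (BoxV Ho)) (K : Type) [Field K] (k : ℕ) :
    hilbertFunction K P k = {e : PVertex P →₀ ℕ | e.degree = k ∧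
      (e.support : Set (PVertex P)).Pairwise fun u v => RVh Ho u.1 v.1}.ncard := by
  have hB := boxV_sys hc
  let ν : (PVertex P →₀ ℕ) → (PVertex P →₀ ℕ) := fun e => lft P (nf (BoxV Ho) (emb e))
  have hνe : ∀ e, emb (ν e) = nf (BoxV Ho) (emb e) := fun e =>
    emb_lft _ (red_mem h K e _ (nf_red _ _)).1
  have hdeg : ∀ e, (ν e).degree = e.degree := by
    intro e
    rw [← card_emb, hνe, nf_card, card_emb]
  have hfin : {e : PVertex P →₀ ℕ | e.degree = k}.Finite := by
    have : {e : PVertex P →₀ ℕ | e.degree = k} =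
        ((finsuppAntidiag univ k : Finset (PVertex P →₀ ℕ)) : Set (PVertex P →₀ ℕ)) := by
      ext m
      simp only [Set.mem_ofPred_eq, Finsupp.degree_eq_sum, Finset.mem_coe, mem_finsuppAntidiag,
        Finset.subset_univ, and_true]
    rw [this]
    exact Finset.finite_toSet _
  have main := binom_finrank (K := K) ν (innerMinors K P) ?_ ?_ ?_ {e | e.degree = k} hfin ?_
  · unfold hilbertFunction
    rw [MvPolynomial.homogeneousSubmodule_eq_finsupp_supported,
      AddMonoidAlgebra.supported_eq_span_single]
    refine main.trans ?_
    congr 1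
    ext e
    refine and_congr_right fun _ => ?_
    have e1 : ν e = e ↔ Nrm (BoxV Ho) (emb e) := by
      constructor
      · intro he
        have := hνe e
        rw [he] at this
        rw [this]; exact nf_nrm _ _
      · intro he
        simp only [ν, he.nf_eq, lft_emb]
    rw [e1, nrm_iff]
    have e2 : ∀ u, u ∈ emb e ↔ ∃ v ∈ e.support, v.1 = u := by
      intro u; simp [emb]
    constructor
    · intro H u hu v hv _
      exact ⟨H _ ((e2 _).2 ⟨u, hu, rfl⟩) _ ((e2 _).2 ⟨v, hv, rfl⟩),
        H _ ((e2 _).2 ⟨v, hv, rfl⟩) _ ((e2 _).2 ⟨u, hu, rfl⟩)⟩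
    · intro H u hu v hv r
      obtain ⟨u', hu', rfl⟩ := (e2 _).1 hu
      obtain ⟨v', hv', rfl⟩ := (e2 _).1 hv
      refine (H hu' hv' ?_).1 r
      rintro rfl
      exact lt_irrefl _ r.1
  · rintro g ⟨a, b, c, d, hi, hcc, hdd, rfl⟩
    refine ⟨Finsupp.single a 1 + Finsupp.single b 1, Finsupp.single c 1 + Finsupp.single d 1, ?_, ?_⟩
    · simp [MvPolynomial.X, MvPolynomial.monomial_mul]
    · intro e
      simp only [ν]
      congr 1
      symm
      apply nf_eq_of_red hB
      refine .single ⟨c.1, d.1, emb e, ?_, ?_, ?_⟩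
      · have := (h.inner_iff a.2 b.2).1 hi
        rw [hcc, hdd]
        exact this
      · simp only [emb_add, emb_single, ← Multiset.singleton_add]
        abel
      · simp only [emb_add, emb_single, ← Multiset.singleton_add, hcc, hdd]
        abel
  · intro e
    exact (red_mem h K e _ (nf_red _ _)).2
  · intro e
    have := hνe e
    change lft P (nf (BoxV Ho) (emb (ν e))) = lft P (nf (BoxV Ho) (emb e))
    rw [this, nf_idem]
  · intro e he
    exact (hdeg e).trans he

theorem hilbS_eq (h : FP P m n Ho) (hc : Cross (BoxV Ho)) (K : Type) [Field K] :
    hilbertSeries K P = Z (RVh Ho) sser P.vertexSet := by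
  have e1 : Z (RVh Ho) sser P.vertexSet =
      Z (fun u v : PVertex P => RVh Ho u.1 v.1) sser (univ : Finset (PVertex P)) := by
    refine Z_image sser Subtype.val (Subtype.val_injective.injOn) (fun _ _ _ _ _ => Iff.rfl) _ ?_
    intro b
    simp
  ext k
  rw [e1, coeff_Z, hilbertSeries, PowerSeries.coeff_mk, hilb_eq h hc]

end FrameAux

/-! ## Rook configurations -/
namespace FrameAux
open Finset

variable {P : Polyomino} {m n : ℤ} {Ho : ℤ → ℤ → Prop}

/-- same row, connected -/
def RowC (Ho : ℤ → ℤ → Prop) (c d : Pt) : Prop :=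
  c.2 = d.2 ∧ BoxC Ho (min c.1 d.1) (max c.1 d.1) c.2 c.2
/-- same column, connected -/
def ColC (Ho : ℤ → ℤ → Prop) (c d : Pt) : Prop :=
  c.1 = d.1 ∧ BoxC Ho c.1 c.1 (min c.2 d.2) (max c.2 d.2)

theorem RowC.symm {c d : Pt} (h : RowC Ho c d) : RowC Ho d c := by
  obtain ⟨h1, h2⟩ := h
  refine ⟨h1.symm, ?_⟩
  rw [min_comm, max_comm, ← h1]; exact h2
theorem ColC.symm {c d : Pt} (h : ColC Ho c d) : ColC Ho d c := by
  obtain ⟨h1, h2⟩ := h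
  refine ⟨h1.symm, ?_⟩
  rw [min_comm, max_comm, ← h1]; exact h2
theorem RowC.trans {c d e : Pt} (h : RowC Ho c d) (h' : RowC Ho d e) : RowC Ho c e := by
  obtain ⟨h1, h2⟩ := h
  obtain ⟨h3, h4⟩ := h'
  refine ⟨h1.trans h3, fun a b k1 k2 k3 k4 => ?_⟩
  by_cases hx : min c.1 d.1 ≤ a ∧ a ≤ max c.1 d.1
  · exact h2 a b hx.1 hx.2 k3 k4
  · exact h4 a b (by omega) (by omega) (by omega) (by omega)
theorem ColC.trans {c d e : Pt} (h : ColC Ho c d) (h' : ColC Ho d e) : ColC Ho c e := by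
  obtain ⟨h1, h2⟩ := h
  obtain ⟨h3, h4⟩ := h'
  refine ⟨h1.trans h3, fun a b k1 k2 k3 k4 => ?_⟩
  by_cases hx : min c.2 d.2 ≤ b ∧ b ≤ max c.2 d.2
  · exact h2 a b k1 k2 hx.1 hx.2
  · exact h4 a b (by omega) (by omega) (by omega) (by omega)

theorem FP.att_iff (h : FP P m n Ho) {c d : Pt} (hc : c ∈ P.cells) (hd : d ∈ P.cells) :
    attacking P c d ↔ c ≠ d ∧ (RowC Ho c d ∨ ColC Ho c d) := by
  obtain ⟨c1, c2⟩ := c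
  obtain ⟨d1, d2⟩ := d
  rw [h] at hc hd
  simp only [attacking, RowC, ColC, BoxC, h _ _]
  refine and_congr_right fun _ => or_congr (and_congr_right fun e => ?_) (and_congr_right fun e => ?_)
  · constructor
    · intro H a b k1 k2 k3 k4
      obtain rfl : b = c2 := by omega
      exact (H a k1 k2).2.2.2.2
    · intro H x k1 k2
      exact ⟨by omega, by omega, by omega, by omega, H x c2 k1 k2 le_rfl le_rfl⟩
  · constructor
    · intro H a b k1 k2 k3 k4
      obtain rfl : a = c1 := by omega
      exact (H b k3 k4).2.2.2.2
    · intro H x k1 k2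
      exact ⟨by omega, by omega, by omega, by omega, H c1 x le_rfl le_rfl k1 k2⟩

theorem FP.boxC_cells (h : FP P m n Ho) {u v : Pt} (hu : u ∈ P.cells) (hv : v ∈ P.cells)
    (hb : BoxC Ho u.1 v.1 v.2 u.2) {x y : ℤ} (h1 : u.1 ≤ x) (h2 : x ≤ v.1) (h3 : v.2 ≤ y)
    (h4 : y ≤ u.2) : (x, y) ∈ P.cells := by
  obtain ⟨u1, u2⟩ := u
  obtain ⟨v1, v2⟩ := v
  rw [h] at hu hv
  rw [h]
  simp only at *
  exact ⟨by omega, by omega, by omega, by omega, hb _ _ (by omega) (by omega) (by omega) (by omega)⟩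

/-- Step on rook configurations. -/
theorem FP.rook_step (h : FP P m n Ho) {R : Finset Pt} (hR : IsRookConfig P R) {M : Multiset Pt}
    (hs : Stp (BoxC Ho) R.val M) :
    ∃ R' : Finset Pt, R'.val = M ∧ IsRookConfig P R' ∧ switchStep P R R' := by
  obtain ⟨u, v, N, ⟨r1, r2, r3⟩, eR, rfl⟩ := hs
  have hnd := R.nodup
  rw [eR, Multiset.nodup_cons, Multiset.nodup_cons] at hnd
  obtain ⟨n1, n2, n3⟩ := hnd
  have mR : ∀ x, x ∈ R ↔ x = u ∨ x = v ∨ x ∈ N := by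
    intro x; rw [← Finset.mem_val, eR]; simp
  rw [Multiset.mem_cons, not_or] at n1
  have hu : u ∈ P.cells := hR.1 (by simp [mR])
  have hv : v ∈ P.cells := hR.1 (by simp [mR])
  have hcel := fun x y => h.boxC_cells (x := x) (y := y) hu hv r3
  have hp : (u.1, v.2) ∈ P.cells := hcel _ _ le_rfl r1.le le_rfl r2.le
  have hq : (v.1, u.2) ∈ P.cells := hcel _ _ r1.le le_rfl r2.le le_rfl
  have na : ∀ x ∈ R, ∀ y ∈ R, x ≠ y → ¬ RowC Ho x y ∧ ¬ ColC Ho x y := by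
    intro x hx y hy hxy
    have := hR.2 x hx y hy
    rw [h.att_iff (hR.1 hx) (hR.1 hy)] at this
    tauto
  have up : ColC Ho u (u.1, v.2) := ⟨rfl, fun a b k1 k2 k3 k4 => r3 a b (by omega) (by omega) (by simp at *; omega) (by simp at *; omega)⟩
  have vp : RowC Ho v (u.1, v.2) := ⟨rfl, fun a b k1 k2 k3 k4 => r3 a b (by simp at *; omega) (by simp at *; omega) (by omega) (by omega)⟩
  have uq : RowC Ho u (v.1, u.2) := ⟨rfl, fun a b k1 k2 k3 k4 => r3 a b (by simp at *; omega) (by simp at *; omega) (by omega) (by omega)⟩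
  have vq : ColC Ho v (v.1, u.2) := ⟨rfl, fun a b k1 k2 k3 k4 => r3 a b (by omega) (by omega) (by simp at *; omega) (by simp at *; omega)⟩
  have uR : u ∈ R := by simp [mR]
  have vR : v ∈ R := by simp [mR]
  have pW : ∀ w ∈ N, ¬ RowC Ho (u.1, v.2) w ∧ ¬ ColC Ho (u.1, v.2) w := by
    intro w hw
    have wR : w ∈ R := by simp [mR, hw]
    have uw : u ≠ w := by rintro rfl; exact n1.2 hw
    have vw : v ≠ w := by rintro rfl; exact n2 hw
    exact ⟨fun k => (na v vR w wR vw).1 (vp.trans k), fun k => (na u uR w wR uw).2 (up.trans k)⟩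
  have qW : ∀ w ∈ N, ¬ RowC Ho (v.1, u.2) w ∧ ¬ ColC Ho (v.1, u.2) w := by
    intro w hw
    have wR : w ∈ R := by simp [mR, hw]
    have uw : u ≠ w := by rintro rfl; exact n1.2 hw
    have vw : v ≠ w := by rintro rfl; exact n2 hw
    exact ⟨fun k => (na u uR w wR uw).1 (uq.trans k), fun k => (na v vR w wR vw).2 (vq.trans k)⟩
  have rfl1 : ∀ x : Pt, x ∈ P.cells → RowC Ho x x := by
    rintro ⟨x, y⟩ hx
    refine ⟨rfl, fun a b k1 k2 k3 k4 => ?_⟩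
    simp only [min_self, max_self] at k1 k2 k3 k4
    obtain rfl : a = x := by omega
    obtain rfl : b = y := by omega
    exact ((h _ _).1 hx).2.2.2.2
  have pN : (u.1, v.2) ∉ N := fun k => (pW _ k).1 (rfl1 _ hp)
  have qN : (v.1, u.2) ∉ N := fun k => (qW _ k).1 (rfl1 _ hq)
  have pq : (u.1, v.2) ≠ (v.1, u.2) := fun e => by simp only [Prod.mk.injEq] at e; omega
  refine ⟨⟨(u.1, v.2) ::ₘ (v.1, u.2) ::ₘ N, ?_⟩, rfl, ⟨?_, ?_⟩, ?_⟩
  · rw [Multiset.nodup_cons, Multiset.nodup_cons, Multiset.mem_cons]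
    exact ⟨by tauto, qN, n3⟩
  · intro x hx
    simp only [SetLike.mem_coe, Finset.mem_mk, Multiset.mem_cons] at hx
    rcases hx with rfl | rfl | hx
    · exact hp
    · exact hq
    · exact hR.1 (by simp [mR, hx])
  · have cN : ∀ x ∈ N, x ∈ P.cells := fun x hx => hR.1 (by simp [mR, hx])
    have pq1 : ¬ RowC Ho (u.1, v.2) (v.1, u.2) := fun k => by have := k.1; simp only at this; omega
    have pq2 : ¬ ColC Ho (u.1, v.2) (v.1, u.2) := fun k => by have := k.1; simp only at this; omega
    intro x hx y hy hat
    simp only [Finset.mem_mk, Multiset.mem_cons] at hx hy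
    rcases hx with rfl | rfl | hx <;> rcases hy with rfl | rfl | hy
    · exact hat.1 rfl
    · rw [h.att_iff hp hq] at hat; tauto
    · rw [h.att_iff hp (cN _ hy)] at hat; have := pW _ hy; tauto
    · rw [h.att_iff hq hp] at hat
      rcases hat.2 with k | k
      · exact pq1 k.symm
      · exact pq2 k.symm
    · exact hat.1 rfl
    · rw [h.att_iff hq (cN _ hy)] at hat; have := qW _ hy; tauto
    · rw [h.att_iff (cN _ hx) hp] at hat
      rcases hat.2 with k | k
      · exact (pW _ hx).1 k.symm
      · exact (pW _ hx).2 k.symm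
    · rw [h.att_iff (cN _ hx) hq] at hat
      rcases hat.2 with k | k
      · exact (qW _ hx).1 k.symm
      · exact (qW _ hx).2 k.symm
    · exact hR.2 x (by simp [mR, hx]) y (by simp [mR, hy]) hat
  · refine ⟨(u.1, v.2), (v.1 + 1, u.2 + 1), ⟨by simp only; omega, by simp only; omega, ?_⟩, Or.inr ?_⟩
    · rintro ⟨x, y⟩ ⟨k1, k2, k3, k4⟩
      simp only at k1 k2 k3 k4
      exact hcel x y (by omega) (by omega) (by omega) (by omega)
    · simp only [add_sub_cancel_right]
      refine ⟨uR, vR, ?_⟩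
      ext x
      simp only [Finset.mem_mk, Multiset.mem_cons, mem_insert, mem_erase, mR]
      have : x ∈ N → x ≠ u ∧ x ≠ v := fun hx => ⟨by rintro rfl; exact n1.2 hx, by rintro rfl; exact n2 hx⟩
      tauto

theorem insert2_val {R : Finset Pt} {a b : Pt} (ha : a ∉ R) (hb : b ∉ R) (hab : a ≠ b) :
    (insert a (insert b R)).val = a ::ₘ b ::ₘ R.val := by
  rw [Finset.insert_val_of_notMem (by simp [ha, hab]), Finset.insert_val_of_notMem hb]

theorem erase2_val {R : Finset Pt} {a b : Pt} (ha : a ∈ R) (hb : b ∈ R) (hab : a ≠ b) :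
    R.val = a ::ₘ b ::ₘ ((R.erase a).erase b).val := by
  rw [Finset.erase_val, Finset.erase_val, Multiset.cons_erase, Multiset.cons_erase]
  · exact ha
  · exact (Multiset.mem_erase_of_ne hab.symm).2 hb

theorem FP.switch_nf (h : FP P m n Ho) (hB : BoxSys (BoxC Ho)) {R S : Finset Pt}
    (hR : IsRookConfig P R)
    (hs : switchStep P R S) : nf (BoxC Ho) R.val = nf (BoxC Ho) S.val := by
  obtain ⟨⟨a1, a2⟩, ⟨b1', b2'⟩, ⟨i1, i2, i3⟩, hs⟩ := hs
  obtain ⟨b1, rfl⟩ : ∃ b, b1' = b + 1 := ⟨b1' - 1, by omega⟩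
  obtain ⟨b2, rfl⟩ : ∃ b, b2' = b + 1 := ⟨b2' - 1, by omega⟩
  simp only [add_sub_cancel_right] at hs i1 i2
  have cel : ∀ x y, a1 ≤ x → x ≤ b1 → a2 ≤ y → y ≤ b2 → (x, y) ∈ P.cells := by
    intro x y k1 k2 k3 k4
    exact i3 (x, y) ⟨k1, by simp only; omega, k3, by simp only; omega⟩
  have bx : BoxC Ho a1 b1 a2 b2 := fun x y k1 k2 k3 k4 => ((h _ _).1 (cel x y k1 k2 k3 k4)).2.2.2.2
  have na : ∀ x ∈ R, ∀ y ∈ R, x ≠ y → ¬ RowC Ho x y ∧ ¬ ColC Ho x y := by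
    intro x hx y hy hxy
    have := hR.2 x hx y hy
    rw [h.att_iff (hR.1 hx) (hR.1 hy)] at this
    tauto
  have row : ∀ y, a2 ≤ y → y ≤ b2 → RowC Ho (a1, y) (b1, y) := fun y h1 h2 =>
    ⟨rfl, fun a b k1 k2 k3 k4 => bx a b (by simp at *; omega) (by simp at *; omega) (by simp at *; omega) (by simp at *; omega)⟩
  have col : ∀ x, a1 ≤ x → x ≤ b1 → ColC Ho (x, a2) (x, b2) := fun y h1 h2 =>
    ⟨rfl, fun a b k1 k2 k3 k4 => bx a b (by simp at *; omega) (by simp at *; omega) (by simp at *; omega) (by simp at *; omega)⟩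
  rcases hs with ⟨s1, s2, rfl⟩ | ⟨s1, s2, rfl⟩
  · by_cases e1 : a1 = b1
    · subst e1
      by_cases e2 : a2 = b2
      · subst e2
        congr 2
        ext x; simp only [mem_insert, mem_erase]
        by_cases k : x = (a1, a2)
        · subst k; tauto
        · tauto
      · exact absurd (col a1 le_rfl le_rfl) (na _ s1 _ s2 (by simp [e2])).2
    by_cases e2 : a2 = b2
    · subst e2
      exact absurd (row a2 le_rfl le_rfl) (na _ s1 _ s2 (by simp [e1])).1
    symm
    apply nf_eq_of_red hB
    refine .single ⟨(a1, b2), (b1, a2), _, ⟨by simp only; omega, by simp only; omega, bx⟩,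
      insert2_val ?_ ?_ ?_, erase2_val s1 s2 (by simp [e1])⟩
    · intro k
      simp only [mem_erase] at k
      exact (na _ s1 _ k.2.2 (by simp [e2])).2 (col a1 le_rfl (by omega))
    · intro k
      simp only [mem_erase] at k
      exact (na _ s1 _ k.2.2 (by simp [e1])).1 (row a2 le_rfl (by omega))
    · simp [e1]
  · by_cases e1 : a1 = b1
    · subst e1
      by_cases e2 : a2 = b2
      · subst e2
        congr 2
        ext x; simp only [mem_insert, mem_erase]
        by_cases k : x = (a1, a2)
        · subst k; tauto
        · tauto
      · exact absurd (col a1 le_rfl le_rfl) (na _ s2 _ s1 (by simp [e2])).2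
    by_cases e2 : a2 = b2
    · subst e2
      exact absurd (row a2 le_rfl le_rfl) (na _ s1 _ s2 (by simp [e1])).1
    apply nf_eq_of_red hB
    refine .single ⟨(a1, b2), (b1, a2), _, ⟨by simp only; omega, by simp only; omega, bx⟩,
      erase2_val s1 s2 (by simp [e1]), insert2_val ?_ ?_ ?_⟩
    · intro k
      simp only [mem_erase] at k
      exact (na _ k.2.2 _ s1 (by simp [e2])).2 (col a1 le_rfl (by omega))
    · intro k
      simp only [mem_erase] at k
      exact (na _ s1 _ k.2.2 (by simp [e1])).1 (row b2 (by omega) le_rfl)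
    · simp [e1]

theorem FP.canon_iff (h : FP P m n Ho) {W : Finset Pt} (hW : W ⊆ P.cells) :
    (W : Set Pt).Pairwise (RCh Ho) ↔ IsRookConfig P W ∧ Nrm (BoxC Ho) W.val := by
  rw [nrm_iff]
  constructor
  · intro H
    refine ⟨⟨by exact_mod_cast hW, ?_⟩, ?_⟩
    · intro c hc d hd hat
      rw [h.att_iff (hW hc) (hW hd)] at hat
      obtain ⟨hne, hat⟩ := hat
      have := H hc hd hne
      simp only [RCh, NBc] at this
      rcases hat with ⟨k1, k2⟩ | ⟨k1, k2⟩
      · rcases le_total c.1 d.1 with l | l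
        · rw [min_eq_left l, max_eq_right l] at k2
          exact this.1 ⟨l, k1.symm.le, hne, by rw [← k1]; exact k2⟩
        · rw [min_eq_right l, max_eq_left l] at k2
          exact this.2 ⟨l, k1.le, hne.symm, by rw [← k1]; exact k2⟩
      · rcases le_total c.2 d.2 with l | l
        · rw [min_eq_left l, max_eq_right l] at k2
          exact this.2 ⟨k1.symm.le, l, hne.symm, by rw [← k1]; exact k2⟩
        · rw [min_eq_right l, max_eq_left l] at k2
          exact this.1 ⟨k1.le, l, hne, by rw [← k1]; exact k2⟩
    · intro u hu v hv r
      have hne : u ≠ v := by rintro rfl; exact lt_irrefl _ r.1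
      exact (H hu hv hne).1 ⟨r.1.le, r.2.1.le, hne, r.2.2⟩
  · rintro ⟨h1, h2⟩
    have key : ∀ u ∈ W, ∀ v ∈ W, ¬ NBc Ho u v := by
      rintro u hu v hv ⟨k1, k2, k3, k4⟩
      rcases k1.eq_or_lt with e | e
      · refine h1.2 u hu v hv ((h.att_iff (hW hu) (hW hv)).2 ⟨k3, Or.inr ⟨e, ?_⟩⟩)
        rw [min_eq_right k2, max_eq_left k2]
        rw [← e] at k4; exact k4
      rcases k2.eq_or_lt with e' | e'
      · refine h1.2 u hu v hv ((h.att_iff (hW hu) (hW hv)).2 ⟨k3, Or.inl ⟨e'.symm, ?_⟩⟩)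
        rw [min_eq_left k1, max_eq_right k1]
        rw [e'] at k4; exact k4
      exact h2 u hu v hv ⟨e, e', k4⟩
    exact fun u hu v hv _ => ⟨key u hu v hv, key v hv u hu⟩

theorem coeff_ZX {α : Type} (r : α → α → Prop) (V : Finset α) (k : ℕ) :
    PowerSeries.coeff k (Z r (PowerSeries.X : PowerSeries ℤ) V) =
      ({W : Finset α | W ⊆ V ∧ (W : Set α).Pairwise r ∧ W.card = k}.ncard : ℤ) := by
  classical
  have e : {W : Finset α | W ⊆ V ∧ (W : Set α).Pairwise r ∧ W.card = k} =
      (((V.powerset.filter (fun W : Finset α => (W : Set α).Pairwise r)).filter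
        fun W => k = W.card : Finset (Finset α)) : Set (Finset α)) := by
    ext W
    simp only [Set.mem_ofPred_eq, coe_filter, mem_filter, mem_powerset, eq_comm (a := k)]
    tauto
  rw [e, Set.ncard_coe_finset, Z, map_sum, Finset.card_filter, Nat.cast_sum]
  simp only [PowerSeries.coeff_X_pow, Nat.cast_ite, Nat.cast_one, Nat.cast_zero]

theorem rtil_eq (h : FP P m n Ho) (hc : Cross (BoxC Ho)) (k : ℕ) :
    (rtil P k : ℤ) = PowerSeries.coeff k (Z (RCh Ho) (PowerSeries.X : PowerSeries ℤ) P.cells) := by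
  have hB := boxC_sys hc
  rw [coeff_ZX, Nat.cast_inj, ← Nat.card_coe_set_eq, rtil]
  symm
  let f : {W : Finset Pt | W ⊆ P.cells ∧ (W : Set Pt).Pairwise (RCh Ho) ∧ W.card = k} →
    Quot (fun R S : RookConfigType P k => switchStep P R.1 S.1) :=
    fun W => Quot.mk _ ⟨W.1, ((h.canon_iff W.2.1).1 W.2.2.1).1, W.2.2.2⟩
  let g : Quot (fun R S : RookConfigType P k => switchStep P R.1 S.1) → Multiset Pt :=
    Quot.lift (fun R => nf (BoxC Ho) R.1.val) fun R S hs => h.switch_nf hB R.2.1 hs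
  apply Nat.card_eq_of_bijective f
  constructor
  · intro W W' e
    have e' := congrArg g e
    have e2 : nf (BoxC Ho) W.1.val = nf (BoxC Ho) W'.1.val := e'
    rw [(((h.canon_iff W.2.1).1 W.2.2.1).2).nf_eq, (((h.canon_iff W'.2.1).1 W'.2.2.1).2).nf_eq] at e2
    exact Subtype.ext (Finset.val_injective e2)
  · intro q
    induction q using Quot.ind with
    | mk R =>
    have key : ∀ N, Relation.ReflTransGen (Stp (BoxC Ho)) R.1.val N →
        ∃ R' : RookConfigType P k, R'.1.val = N ∧
          Quot.mk (fun R S : RookConfigType P k => switchStep P R.1 S.1) R' = Quot.mk _ R := by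
      intro N hN
      induction hN with
      | refl => exact ⟨R, rfl, rfl⟩
      | tail _ hs ih =>
        obtain ⟨R', rfl, e⟩ := ih
        obtain ⟨R'', e1, e2, e3⟩ := h.rook_step R'.2.1 hs
        refine ⟨⟨R'', e2, ?_⟩, e1, ?_⟩
        · rw [Finset.card_def, e1, hs.card_eq]; exact R'.2.2
        · rw [← e]
          exact (Quot.sound (r := fun R S : RookConfigType P k => switchStep P R.1 S.1) e3).symm
    obtain ⟨R', e1, e2⟩ := key _ (nf_red _ _)
    have hsub : R'.1 ⊆ P.cells := by exact_mod_cast R'.2.1.1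
    refine ⟨⟨R'.1, hsub, (h.canon_iff hsub).2 ⟨R'.2.1, ?_⟩, R'.2.2⟩, e2⟩
    rw [e1]; exact nf_nrm _ _

end FrameAux

namespace FrameAux
open Finset

theorem krull_le_of_integral {A R : Type} [CommRing A] [CommRing R] (g : A →+* R) (hg : g.IsIntegral) :
    ringKrullDim R ≤ ringKrullDim A := by
  algebraize [g]
  unfold ringKrullDim
  refine Order.krullDim_le_of_strictMono (PrimeSpectrum.comap (algebraMap A R)) ?_
  intro I J hIJ
  have := Ideal.IsIntegral.comap_lt_comap (R := A) (I := I.asIdeal) (J := J.asIdeal) hIJ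
  exact this

section growth
variable {σ K : Type} [Fintype σ] [Field K] (J : Ideal (MvPolynomial σ K))

/-- The graded piece of the quotient. -/
noncomputable def gp (k : ℕ) : Submodule K (MvPolynomial σ K ⧸ J) :=
  Submodule.map (Ideal.Quotient.mkₐ K J).toLinearMap (MvPolynomial.homogeneousSubmodule σ K k)

/-- The degree filtration. -/
noncomputable def FF : ℕ → Submodule K (MvPolynomial σ K ⧸ J)
  | 0 => gp J 0
  | k + 1 => FF k ⊔ gp J (k + 1)

theorem gp_fin (k : ℕ) : FiniteDimensional K (gp J k) := by
  classical
  have : FiniteDimensional K (MvPolynomial.homogeneousSubmodule σ K k) := by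
    have h : MvPolynomial.homogeneousSubmodule σ K k ≤ MvPolynomial.restrictTotalDegree σ K k := by
      intro p hp
      rw [MvPolynomial.mem_restrictTotalDegree]
      exact MvPolynomial.IsHomogeneous.totalDegree_le hp
    exact Submodule.finiteDimensional_of_le h
  unfold gp
  infer_instance

theorem FF_fin (k : ℕ) : FiniteDimensional K (FF J k) := by
  induction k with
  | zero => exact gp_fin J 0
  | succ k ih =>
    have := gp_fin J (k + 1)
    change FiniteDimensional K (FF J k ⊔ gp J (k + 1) : Submodule K (MvPolynomial σ K ⧸ J))
    infer_instance

theorem FF_rank (k : ℕ) : Module.finrank K (FF J k) ≤ ∑ j ∈ range (k + 1), Module.finrank K (gp J j) := by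
  induction k with
  | zero => rw [sum_range_one]; exact le_rfl
  | succ k ih =>
    have := gp_fin J (k + 1)
    have := FF_fin J k
    rw [sum_range_succ]
    exact (Submodule.finrank_add_le_finrank_add_finrank _ _).trans (by omega)

theorem gp_le_FF {j k : ℕ} (h : j ≤ k) : gp J j ≤ FF J k := by
  induction k with
  | zero => obtain rfl : j = 0 := by omega
            exact le_rfl
  | succ k ih =>
    by_cases hj : j = k + 1
    · subst hj; exact le_sup_right
    · exact (ih (by omega)).trans le_sup_left

theorem mk_mem_FF {p : MvPolynomial σ K} {k : ℕ} (h : p.totalDegree ≤ k) :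
    Ideal.Quotient.mk J p ∈ FF J k := by
  rw [← MvPolynomial.sum_homogeneousComponent p, map_sum]
  refine Submodule.sum_mem _ fun i hi => gp_le_FF J (j := i) (by simp at hi; omega) ?_
  exact ⟨_, MvPolynomial.homogeneousComponent_mem i p, rfl⟩

theorem growth {s : ℕ} (g : MvPolynomial (Fin s) K →ₐ[K] (MvPolynomial σ K ⧸ J))
    (hg : Function.Injective g) : ∃ e : ℕ, ∀ N : ℕ,
      N ^ s ≤ ∑ j ∈ range (e * N + 1), Module.finrank K (gp J j) := by
  choose p hp using fun i => Ideal.Quotient.mk_surjective (g (MvPolynomial.X i))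
  refine ⟨∑ i, (p i).totalDegree, fun N => ?_⟩
  let ι := Fin s → Fin N
  let ex : ι → (Fin s →₀ ℕ) := fun a => Finsupp.equivFunOnFinite.symm fun i => (a i : ℕ)
  let b : ι → (MvPolynomial σ K ⧸ J) := fun a => g (MvPolynomial.monomial (ex a) 1)
  have hex : Function.Injective ex := by
    intro a a' h
    have h' := Finsupp.equivFunOnFinite.symm.injective h
    funext i
    exact Fin.ext (congrFun h' i)
  have hb : LinearIndependent K b := by
    have h1 : LinearIndependent K fun a : ι => (MvPolynomial.monomial (ex a) (1 : K)) := by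
      have := (MvPolynomial.basisMonomials (Fin s) K).linearIndependent.comp ex hex
      simpa [Function.comp_def] using this
    exact h1.map' g.toLinearMap (LinearMap.ker_eq_bot.2 hg)
  have h2 := finrank_span_eq_card hb
  have hc : Fintype.card ι = N ^ s := by simp [ι]
  have := FF_fin J ((∑ i, (p i).totalDegree) * N)
  have h3 : Submodule.span K (Set.range b) ≤ FF J ((∑ i, (p i).totalDegree) * N) := by
    rw [Submodule.span_le]
    rintro _ ⟨a, rfl⟩
    have : b a = Ideal.Quotient.mk J (∏ i, p i ^ (a i : ℕ)) := by
      simp only [b, map_prod, map_pow, hp]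
      rw [MvPolynomial.monomial_eq]
      simp [ex, Finsupp.prod_fintype]
    rw [this]
    refine mk_mem_FF J ((MvPolynomial.totalDegree_finsetProd _ _).trans ?_)
    rw [sum_mul]
    refine sum_le_sum fun i _ => (MvPolynomial.totalDegree_pow _ _).trans ?_
    rw [mul_comm]
    exact Nat.mul_le_mul_left _ (a i).2.le
  rw [← hc, ← h2]
  exact (Submodule.finrank_mono h3).trans (FF_rank J _)

theorem dim_le_of_poly_growth {d' B : ℕ} {d : ℕ}
    (hd : ringKrullDim (MvPolynomial σ K ⧸ J) = (d : WithBot (WithTop ℕ)))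
    (hB : ∀ M, ∑ j ∈ range (M + 1), Module.finrank K (gp J j) ≤ B * (M + d') ^ d') : d ≤ d' := by
  have hnt : Nontrivial (MvPolynomial σ K ⧸ J) := by
    by_contra h
    rw [not_nontrivial_iff_subsingleton] at h
    rw [ringKrullDim_eq_bot_of_subsingleton] at hd
    exact absurd hd.symm (by exact WithBot.natCast_ne_bot d)
  obtain ⟨s, g, hg, hi⟩ := exists_integral_inj_algHom_of_fg K (MvPolynomial σ K ⧸ J)
  have h1 := krull_le_of_integral g.toRingHom hi
  rw [MvPolynomial.ringKrullDim_of_isNoetherianRing, hd, ringKrullDim_eq_zero_of_field] at h1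
  have h2 : d ≤ s := by
    rw [zero_add, Nat.card_fin] at h1
    exact Nat.cast_le (α := ℕ∞).1 (WithBot.coe_le_coe.1 h1)
  obtain ⟨e, he⟩ := growth J g hg
  refine h2.trans ?_
  by_contra hs
  push Not at hs
  set N := B * (e + d') ^ d' + 1 with hN
  have h3 := (he N).trans (hB _)
  have h4 : B * (e * N + d') ^ d' ≤ B * ((e + d') * N) ^ d' := by
    gcongr
    rw [add_mul]
    have : d' ≤ d' * N := Nat.le_mul_of_pos_right _ (by omega)
    omega
  have h5 : N ^ (d' + 1) ≤ N ^ s := Nat.pow_le_pow_right (by omega) hs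
  have h6 : N * N ^ d' ≤ (B * (e + d') ^ d') * N ^ d' := by
    calc N * N ^ d' = N ^ (d' + 1) := by ring
      _ ≤ _ := h5.trans (h3.trans h4)
      _ = _ := by rw [mul_pow]; ring
  have h7 := Nat.le_of_mul_le_mul_right h6 (by positivity)
  omega
end growth

theorem psum_coeff (f : PowerSeries ℤ) (M : ℕ) :
    PowerSeries.coeff M (PowerSeries.mk 1 * f) = ∑ j ∈ range (M + 1), PowerSeries.coeff j f := by
  rw [mul_comm, PowerSeries.coeff_mul, Finset.Nat.sum_antidiagonal_eq_sum_range_succ_mk]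
  simp

theorem bound_of_series {f : PowerSeries ℤ} {r : Polynomial ℤ} {d' : ℕ} (hr : ∀ k, 0 ≤ r.coeff k)
    (h : (1 - PowerSeries.X) ^ d' * f = (r : PowerSeries ℤ)) (M : ℕ) :
    ∑ j ∈ range (M + 1), PowerSeries.coeff j f ≤ r.eval 1 * (M + d' : ℤ) ^ d' := by
  have h0 : (PowerSeries.mk 1 : PowerSeries ℤ) * (1 - PowerSeries.X) = 1 := PowerSeries.mk_one_mul_one_sub_eq_one ℤ
  have h1 : PowerSeries.mk 1 * f = PowerSeries.mk 1 ^ (d' + 1) * (r : PowerSeries ℤ) := by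
    rw [← h, pow_succ, ← mul_assoc, mul_right_comm _ _ ((1 - PowerSeries.X) ^ d'), ← mul_pow, h0, one_pow, one_mul]
  rw [← psum_coeff, h1, PowerSeries.mk_one_pow_eq_mk_choose_add, mul_comm, PowerSeries.coeff_mul,
    Finset.Nat.sum_antidiagonal_eq_sum_range_succ_mk]
  have h2 : ∀ k ∈ range (M + 1), PowerSeries.coeff k (r : PowerSeries ℤ) *
      PowerSeries.coeff (M - k) (PowerSeries.mk fun n => ((d' + n).choose d' : ℤ)) ≤
      r.coeff k * (M + d' : ℤ) ^ d' := by
    intro k hk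
    rw [Polynomial.coeff_coe, PowerSeries.coeff_mk]
    refine mul_le_mul_of_nonneg_left ?_ (hr k)
    have : (d' + (M - k)).choose d' ≤ (M + d') ^ d' :=
      (Nat.choose_le_pow _ _).trans (Nat.pow_le_pow_left (by omega) _)
    exact_mod_cast this
  refine (sum_le_sum h2).trans ?_
  rw [← sum_mul]
  refine mul_le_mul_of_nonneg_right ?_ (by positivity)
  rw [Polynomial.eval_eq_sum_range' (n := max (r.natDegree + 1) (M + 1)) (by omega)]
  simp only [one_pow, mul_one]
  exact sum_le_sum_of_subset_of_nonneg (by intro x; simp; omega) fun i _ _ => hr i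

theorem coeff_ZP {α : Type} (r : α → α → Prop) (V : Finset α) :
    ((Z r (Polynomial.X : Polynomial ℤ) V : Polynomial ℤ) : PowerSeries ℤ) = Z r PowerSeries.X V := by
  simp only [Z]
  rw [← Polynomial.coeToPowerSeries.ringHom_apply, map_sum]
  simp

theorem abstract_main {P : Polyomino} {m n : ℤ} {Ho : ℤ → ℤ → Prop} (K : Type) [Field K]
    (hF : FP P m n Ho) (hV : Cross (BoxV Ho)) (hC : Cross (BoxC Ho)) {dd : ℤ}
    (hG : GP sser (PowerSeries.X : PowerSeries ℤ) (RVh Ho) (RCh Ho)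
      (fun x y => (x, y) ∈ P.vertexSet) (fun x y => (x, y) ∈ P.cells) dd)
    (h : Polynomial ℤ) (d : ℕ)
    (hd : ringKrullDim (CoordRing K P) = (d : WithBot (WithTop ℕ)))
    (hh : hilbertSeries K P * (1 - PowerSeries.X) ^ d = (h : PowerSeries ℤ)) :
    ∀ k : ℕ, h.coeff k = (rtil P k : ℤ) := by
  obtain ⟨V', C', d', hV', hC', -, hgood⟩ := hG
  obtain rfl : V' = P.vertexSet := by ext ⟨x, y⟩; exact hV' x y
  obtain rfl : C' = P.cells := by ext ⟨x, y⟩; exact hC' x y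
  unfold Good at hgood
  rw [← hilbS_eq hF hV K] at hgood
  set r : Polynomial ℤ := Z (RCh Ho) Polynomial.X P.cells with hrdef
  have hrc : ∀ k, r.coeff k = (rtil P k : ℤ) := by
    intro k
    rw [rtil_eq hF hC, ← coeff_ZP, Polynomial.coeff_coe]
  rw [← coeff_ZP, ← hrdef] at hgood
  have hr0 : ∀ k, 0 ≤ r.coeff k := fun k => by rw [hrc]; positivity
  have hr1 : 0 < r.eval 1 := by
    have h0 : r.coeff 0 = 1 := by
      have := coeff_ZX (RCh Ho) P.cells 0
      rw [← coeff_ZP, Polynomial.coeff_coe, ← hrdef] at this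
      rw [this]
      have h2 : {W | W ⊆ P.cells ∧ (W : Set Pt).Pairwise (RCh Ho) ∧ W.card = 0} = {(∅ : Finset Pt)} := by
        ext W
        simp only [Set.mem_ofPred_eq, Set.mem_singleton_iff, Finset.card_eq_zero]
        constructor
        · rintro ⟨_, _, h⟩; exact h
        · rintro rfl; simp
      rw [h2]; simp
    rw [Polynomial.eval_eq_sum_range]
    have h3 := single_le_sum (f := fun i => r.coeff i * 1 ^ i) (s := range (r.natDegree + 1))
      (fun i _ => by simpa using hr0 i) (a := 0) (by simp)
    simp only [h0] at h3
    linarith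
  have hle : d ≤ d' := by
    refine dim_le_of_poly_growth (polyIdeal K P) (B := (r.eval 1).toNat) hd fun M => ?_
    have := bound_of_series hr0 hgood M
    simp only [hilbertSeries, PowerSeries.coeff_mk] at this
    have h4 : ((r.eval 1).toNat : ℤ) = r.eval 1 := Int.toNat_of_nonneg hr1.le
    zify
    rw [h4]
    exact this
  have key : r = h * (1 - Polynomial.X) ^ (d' - d) := by
    apply Polynomial.coe_injective
    rw [← hgood]
    push_cast
    rw [← hh, mul_assoc, ← pow_add, Nat.add_sub_cancel' hle, mul_comm]
  have heq : d' - d = 0 := by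
    by_contra hne
    rw [key] at hr1
    simp [hne] at hr1
  intro k
  rw [← hrc, key, heq]
  simp

end FrameAux

namespace FrameAux
open Finset

/-- Point `i` of a path. -/
def pt (L : List Pt) (i : ℕ) : Pt := L.getD i (0, 0)

theorem path_step {L : List Pt} (h : IsNEPath L) {i : ℕ} (hi : i + 1 < L.length) :
    pt L (i + 1) = ((pt L i).1 + 1, (pt L i).2) ∨ pt L (i + 1) = ((pt L i).1, (pt L i).2 + 1) := by
  have := List.isChain_iff_getElem.1 h.2 i hi
  simpa [pt, List.getD_eq_getElem, hi, (by omega : i < L.length)] using this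

theorem east_iff (L : List Pt) (x y : ℤ) : eastStepOf L x y ↔
    ∃ i, i + 1 < L.length ∧ pt L i = (x, y) ∧ pt L (i + 1) = (x + 1, y) := by
  unfold eastStepOf
  rw [List.mem_iff_getElem]
  constructor
  · rintro ⟨i, hi, h⟩
    simp only [List.length_zip, List.length_tail] at hi
    simp only [List.getElem_zip, List.getElem_tail, Prod.mk.injEq] at h
    refine ⟨i, by omega, ?_, ?_⟩
    · rw [pt, List.getD_eq_getElem _ _ (by omega)]; exact h.1
    · rw [pt, List.getD_eq_getElem _ _ (by omega)]; exact h.2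
  · rintro ⟨i, hi, h1, h2⟩
    refine ⟨i, by simp only [List.length_zip, List.length_tail]; omega, ?_⟩
    simp only [List.getElem_zip, List.getElem_tail, Prod.mk.injEq]
    rw [pt, List.getD_eq_getElem _ _ (by omega)] at h1 h2
    exact ⟨h1, h2⟩

theorem interior_mem {L : List Pt} {i : ℕ} (h0 : 0 < i) (hi : i + 1 < L.length) :
    pt L i ∈ interiorPts L := by
  unfold interiorPts
  rw [List.mem_iff_getElem]
  refine ⟨i - 1, by simp; omega, ?_⟩
  simp only [List.getElem_dropLast, List.getElem_drop]
  rw [pt, List.getD_eq_getElem _ _ (by omega)]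
  congr 1
  omega

structure PF (L : List Pt) (a0 b0 ak bk : ℤ) (h : ℤ → ℤ) : Prop where
  east : ∀ x y, eastStepOf L x y ↔ a0 ≤ x ∧ x < ak ∧ y = h x
  mono : ∀ x x', a0 ≤ x → x ≤ x' → x' < ak → h x ≤ h x'
  bd : ∀ x, a0 ≤ x → x < ak → b0 ≤ h x ∧ h x ≤ bk
  i1 : ∀ x, a0 < x → x < ak → (x, h x) ∈ interiorPts L
  i2 : ∀ x, a0 < x → x < ak → (x, h (x - 1)) ∈ interiorPts L
  st : h a0 = b0 ∨ (a0, b0 + 1) ∈ interiorPts L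
  en : h (ak - 1) = bk ∨ (ak, bk - 1) ∈ interiorPts L

theorem path_facts {L : List Pt} (hL : IsNEPath L) {a0 b0 ak bk : ℤ} (hh : L.head? = some (a0, b0))
    (hl : L.getLast? = some (ak, bk)) (ha : a0 < ak) (hb : b0 < bk) : ∃ h, PF L a0 b0 ak bk h := by
  obtain ⟨k, hk⟩ : ∃ k, L.length = k + 1 :=
    ⟨L.length - 1, by have := List.length_pos_iff.2 hL.1; omega⟩
  have p0 : pt L 0 = (a0, b0) := by
    rw [pt, List.getD_eq_getElem _ _ (by omega)]
    rw [List.head?_eq_getElem?, List.getElem?_eq_getElem (by omega)] at hh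
    exact Option.some.inj hh
  have pk : pt L k = (ak, bk) := by
    rw [pt, List.getD_eq_getElem _ _ (by omega)]
    rw [List.getLast?_eq_getElem?, List.getElem?_eq_getElem (by omega)] at hl
    have := Option.some.inj hl
    rw [← this]
    congr 1
    omega
  have stp : ∀ i, i < k → ((pt L (i+1)).1 = (pt L i).1 + 1 ∧ (pt L (i+1)).2 = (pt L i).2) ∨
      ((pt L (i+1)).1 = (pt L i).1 ∧ (pt L (i+1)).2 = (pt L i).2 + 1) := by
    intro i hi
    rcases path_step hL (i := i) (by omega) with h | h <;> rw [h] <;> simp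
  have sm : ∀ i, i ≤ k → (pt L i).1 + (pt L i).2 = a0 + b0 + i := by
    intro i
    induction i with
    | zero => simp [p0]
    | succ i ih => intro hi; have := ih (by omega); have := stp i (by omega); push_cast; omega
  have mn : ∀ i j, i ≤ j → j ≤ k → (pt L i).1 ≤ (pt L j).1 ∧ (pt L i).2 ≤ (pt L j).2 := by
    intro i j hij
    induction j, hij using Nat.le_induction with
    | base => intro _; exact ⟨le_rfl, le_rfl⟩
    | succ j hj ih => intro h; have := ih (by omega); have := stp j (by omega); omega
  have ex : ∀ x, a0 ≤ x → x < ak → ∃ i, i < k ∧ (pt L i).1 = x ∧ (pt L (i + 1)).1 = x + 1 := by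
    intro x h1 h2
    by_contra hcon
    push Not at hcon
    have : ∀ i, i ≤ k → (pt L i).1 ≤ x := by
      intro i
      induction i with
      | zero => simp [p0, h1]
      | succ i ih =>
        intro hi
        have := ih (by omega)
        have h3 := stp i (by omega)
        have h4 := hcon i (by omega)
        by_cases h5 : (pt L i).1 = x
        · have := h4 h5; omega
        · omega
    have := this k le_rfl
    rw [pk] at this
    simp at this; omega
  have ex' : ∀ x, ∃ i, a0 ≤ x → x < ak → i < k ∧ (pt L i).1 = x ∧ (pt L (i + 1)).1 = x + 1 := by
    intro x
    by_cases h : a0 ≤ x ∧ x < ak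
    · obtain ⟨i, hi⟩ := ex x h.1 h.2; exact ⟨i, fun _ _ => hi⟩
    · exact ⟨0, fun h1 h2 => absurd ⟨h1, h2⟩ h⟩
  choose ix hix using ex'
  have hk2 : 2 ≤ k := by have := sm k le_rfl; rw [pk] at this; simp at this; omega
  have hs : ∀ x, a0 ≤ x → x < ak → (pt L (ix x + 1)).2 = (pt L (ix x)).2 := by
    intro x h1 h2
    obtain ⟨h3, h4, h5⟩ := hix x h1 h2
    have := stp _ h3; omega
  have bds : ∀ i, i ≤ k → a0 ≤ (pt L i).1 ∧ b0 ≤ (pt L i).2 ∧ (pt L i).1 ≤ ak ∧ (pt L i).2 ≤ bk := by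
    intro i hi
    have h1 := mn 0 i (by omega) hi
    have h2 := mn i k hi le_rfl
    rw [p0] at h1; rw [pk] at h2
    exact ⟨h1.1, h1.2, h2.1, h2.2⟩
  have ipos : ∀ i, i ≤ k → a0 < (pt L i).1 → 0 < i := by
    intro i _ h
    rcases Nat.eq_zero_or_pos i with rfl | h'
    · rw [p0] at h; simp at h
    · exact h'
  have ilt : ∀ i, i ≤ k → (pt L i).1 < ak → i < k := by
    intro i hi h
    rcases hi.eq_or_lt with rfl | h'
    · rw [pk] at h; simp at h
    · exact h'
  refine ⟨fun x => (pt L (ix x)).2, ?_, ?_, ?_, ?_, ?_, ?_, ?_⟩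
  · intro x y
    rw [east_iff]
    constructor
    · rintro ⟨i, hi, h1, h2⟩
      have e1 := bds i (by omega)
      have e2 := bds (i + 1) (by omega)
      rw [h1] at e1; rw [h2] at e2
      simp only at e1 e2
      refine ⟨by omega, by omega, ?_⟩
      obtain ⟨h3, h4, h5⟩ := hix x (by omega) (by omega)
      have : ix x = i := by
        rcases lt_trichotomy (ix x) i with h | h | h
        · have := (mn _ _ (Nat.succ_le_of_lt h) (by omega)).1
          rw [h1] at this; simp only [Nat.succ_eq_add_one] at this; omega
        · exact h
        · have := (mn _ _ (Nat.succ_le_of_lt h) (by omega)).1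
          simp only [Nat.succ_eq_add_one] at this
          rw [h2] at this; simp only at this; omega
      simp only [this, h1]
    · rintro ⟨h1, h2, rfl⟩
      obtain ⟨h3, h4, h5⟩ := hix x h1 h2
      exact ⟨ix x, by omega, Prod.ext h4 rfl, Prod.ext h5 (hs x h1 h2)⟩
  · intro x x' h1 h2 h3
    obtain ⟨g3, g4, g5⟩ := hix x h1 (by omega)
    obtain ⟨g3', g4', g5'⟩ := hix x' (by omega) h3
    by_cases h : ix x ≤ ix x'
    · exact (mn _ _ h (by omega)).2
    · have := (mn (ix x' + 1) (ix x) (by omega) (by omega)).1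
      omega
  · intro x h1 h2
    have := bds (ix x) (hix x h1 h2).1.le
    exact ⟨this.2.1, this.2.2.2⟩
  · intro x h1 h2
    obtain ⟨g3, g4, g5⟩ := hix x h1.le h2
    have : (x, (pt L (ix x)).2) = pt L (ix x) := Prod.ext g4.symm rfl
    simp only [this]
    exact interior_mem (ipos _ (by omega) (by omega)) (by omega)
  · intro x h1 h2
    obtain ⟨g3, g4, g5⟩ := hix (x - 1) (by omega) (by omega)
    have : (x, (pt L (ix (x - 1))).2) = pt L (ix (x - 1) + 1) :=
      Prod.ext (by simp only; omega) (hs (x - 1) (by omega) (by omega)).symm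
    simp only [this]
    have := ilt (ix (x - 1) + 1) (by omega) (by omega)
    exact interior_mem (by omega) (by omega)
  · rcases stp 0 (by omega) with h | h
    · left
      rw [p0] at h
      obtain ⟨g3, g4, g5⟩ := hix a0 le_rfl ha
      have : ix a0 = 0 := by
        by_contra hne
        have := (mn 1 (ix a0) (by omega) (by omega)).1
        simp only [zero_add] at h
        omega
      simp only [this, p0]
    · right
      have : (a0, b0 + 1) = pt L 1 := by
        rw [p0] at h
        exact Prod.ext h.1.symm h.2.symm
      rw [this]
      exact interior_mem (by omega) (by omega)
  · have hk1 : k - 1 + 1 = k := by omega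
    have h0 := stp (k - 1) (by omega)
    rw [hk1, pk] at h0
    simp only at h0
    rcases h0 with h | h
    · left
      obtain ⟨g3, g4, g5⟩ := hix (ak - 1) (by omega) (by omega)
      have : ix (ak - 1) = k - 1 := by
        by_contra hne
        have := (mn (ix (ak - 1) + 1) (k - 1) (by omega) (by omega)).1
        omega
      simp only [this]
      omega
    · right
      have : (ak, bk - 1) = pt L (k - 1) := Prod.ext h.1 (by simp only; omega)
      rw [this]
      exact interior_mem (by omega) (by omega)

theorem frame_or_rect (D : FrameData) :
    (∃ F : Fr, F.a0 = D.a0 ∧ F.b0 = D.b0 ∧ F.ak = D.ak ∧ F.bk = D.bk ∧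
      ∀ x y, (x, y) ∈ D.holeCells ↔ F.H x y) ∨ (∀ x y, (x, y) ∉ D.holeCells) := by
  obtain ⟨h1, H1⟩ := path_facts D.par.ne1 D.head1 D.last1 D.hak D.hbk
  obtain ⟨h2, H2⟩ := path_facts D.par.ne2 (D.par.headEq ▸ D.head1) (D.par.lastEq ▸ D.last1) D.hak D.hbk
  have hole : ∀ x y, (x, y) ∈ D.holeCells ↔ D.a0 ≤ x ∧ x < D.ak ∧ h2 x ≤ y ∧ y < h1 x := by
    intro x y
    change ((∃ h, eastStepOf D.S1 x h ∧ y < h) ∧ (∃ h, eastStepOf D.S2 x h ∧ h ≤ y)) ↔ _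
    simp only [H1.east, H2.east]
    constructor
    · rintro ⟨⟨_, ⟨e1, e2, rfl⟩, e3⟩, ⟨_, ⟨_, _, rfl⟩, e4⟩⟩
      exact ⟨e1, e2, e4, e3⟩
    · rintro ⟨e1, e2, e4, e3⟩
      exact ⟨⟨_, ⟨e1, e2, rfl⟩, e3⟩, ⟨_, ⟨e1, e2, rfl⟩, e4⟩⟩
  have hak := D.hak
  have hbk := D.hbk
  have gap : ∀ x, D.a0 < x → x < D.ak → h2 x < h1 (x - 1) := fun x e1 e2 =>
    D.par.above _ (H1.i2 x e1 e2) _ (H2.i1 x e1 e2) rfl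
  by_cases hs : h2 D.a0 = D.b0
  · by_cases he : h1 (D.ak - 1) = D.bk
    · left
      refine ⟨⟨fun x => if x < D.a0 then D.b0 + 1 else if D.ak - 1 ≤ x then D.bk else h1 x,
        fun x => if x ≤ D.a0 then D.b0 else if D.ak ≤ x then D.bk - 1 else h2 x,
        D.a0, D.b0, D.ak, D.bk, D.ha0, D.hak, D.hb0, D.hbk, ?_, ?_, ?_, ?_, ?_, ?_, ?_⟩,
        rfl, rfl, rfl, rfl, ?_⟩
      · intro x x' hx
        simp only
        have e1 := fun p q => H1.mono x x' p hx q
        have e2 := H1.bd x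
        have e2' := H1.bd x'
        have e3 := gap (x' + 1)
        have e4 := H2.bd (x' + 1)
        rw [add_sub_cancel_right] at e3
        split_ifs <;> grind
      · intro x x' hx
        simp only
        have e1 := fun p q => H2.mono x x' p hx q
        have e2 := H2.bd x
        have e2' := H2.bd x'
        have e3 := gap x
        have e4 := H1.bd (x - 1)
        split_ifs <;> grind
      · intro x hx; simp [hx]
      · intro x hx
        have : ¬ x ≤ D.a0 := by omega
        simp [hx, this]
      · intro x hx; simp [hx]
      · intro x hx
        have : ¬ x < D.a0 := by omega
        simp only [if_neg this, if_pos hx]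
      · intro x
        have e3 := gap x
        split_ifs <;> grind
      · intro x y
        rw [hole]
        simp only [Fr.H]
        constructor
        · rintro ⟨g1, g2, g3, g4⟩
          refine ⟨g1, g2, ?_, ?_⟩
          · split_ifs with c1 c2
            · obtain rfl : x = D.a0 := by omega
              omega
            · omega
            · exact g3
          · split_ifs with c1 c2
            · omega
            · obtain rfl : x = D.ak - 1 := by omega
              omega
            · exact g4
        · rintro ⟨g1, g2, g3, g4⟩
          refine ⟨g1, g2, ?_, ?_⟩
          · split_ifs at g3 with c1 c2
            · obtain rfl : x = D.a0 := by omega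
              omega
            · omega
            · exact g3
          · split_ifs at g4 with c1 c2
            · omega
            · obtain rfl : x = D.ak - 1 := by omega
              omega
            · exact g4
    · right
      have i1 := H1.en.resolve_left he
      have h2e : h2 (D.ak - 1) = D.bk := by
        by_contra hne
        have := D.par.above _ i1 _ (H2.en.resolve_left hne) rfl
        omega
      have hw : D.ak = D.a0 + 1 := by
        by_contra hne
        have e1 := gap (D.ak - 1) (by omega) (by omega)
        have e2 := H1.bd (D.ak - 1 - 1) (by omega) (by omega)
        omega
      intro x y hxy
      rw [hole] at hxy
      obtain rfl : x = D.ak - 1 := by omega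
      have e2 := H1.bd (D.ak - 1) (by omega) (by omega)
      omega
  · right
    have i1 := H2.st.resolve_left hs
    have h1e : h1 D.a0 = D.b0 := by
      by_contra hne
      have := D.par.above _ (H1.st.resolve_left hne) _ i1 rfl
      simp at this
    have hw : D.ak = D.a0 + 1 := by
      by_contra hne
      have e1 := gap (D.a0 + 1) (by omega) (by omega)
      have e2 := H2.bd (D.a0 + 1) (by omega) (by omega)
      rw [add_sub_cancel_right] at e1
      omega
    intro x y hxy
    rw [hole] at hxy
    obtain rfl : x = D.a0 := by omega
    have e2 := H2.bd D.a0 (by omega) (by omega)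
    omega

end FrameAux

namespace FrameAux
open Finset

theorem frame_vertex {P : Polyomino} {m n : ℤ} (F : Fr) (hF : FP P m n F.H) (hm : F.ak < m) (hn : F.bk < n)
    (x y : ℤ) : F.VC m n x y ↔ (x, y) ∈ P.vertexSet := by
  rw [mem_vertexSet, hF x y, hF (x - 1) y, hF x (y - 1), hF (x - 1) (y - 1)]
  simp only [Fr.VC, Fr.H]
  have := F.ha0
  have := F.hak
  have := F.hb0
  have := F.hbk
  have e1 := F.fb x
  have e2 := F.fb (x - 1)
  have m1 := F.m1 (show x - 1 ≤ x by omega)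
  have m2 := F.m2 (show x - 1 ≤ x by omega)
  constructor
  · rintro ⟨g1, g2, g3, g4, g5⟩
    by_cases hx1 : x = 1
    · by_cases hy : y = n
      · right; right; left; omega
      · left; omega
    by_cases hxm : x = m
    · by_cases hy : y = 1
      · right; left; omega
      · right; right; right; omega
    by_cases hy1 : y = 1
    · left; omega
    by_cases hyn : y = n
    · right; right; left; omega
    rcases g5 with g5 | g5
    · right; right; left
      exact ⟨by omega, by omega, by omega, by omega, fun h => by omega⟩
    · right; left
      exact ⟨by omega, by omega, by omega, by omega, fun h => by omega⟩
  · intro hv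
    have hb : 1 ≤ x ∧ x ≤ m ∧ 1 ≤ y ∧ y ≤ n := by
      rcases hv with h | h | h | h <;> exact ⟨by omega, by omega, by omega, by omega⟩
    refine ⟨hb.1, hb.2.1, hb.2.2.1, hb.2.2.2, ?_⟩
    by_contra hcon
    push Not at hcon
    have c1 : F.a0 < x := by
      by_contra h
      have e3 := F.f2lo x (by omega)
      have e4 := F.f1lo (x - 1) (by omega)
      omega
    have c2 : x < F.ak := by
      by_contra h
      have e3 := F.f2hi x (by omega)
      have e4 := F.f1hi (x - 1) (by omega)
      omega
    rcases hv with ⟨_, _, _, _, h⟩ | ⟨_, _, _, _, h⟩ | ⟨_, _, _, _, h⟩ | ⟨_, _, _, _, h⟩ <;> apply h <;>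
      exact ⟨by omega, by omega, by omega, by omega⟩

theorem rect_vertex {P : Polyomino} {m n : ℤ} (hF : FP P m n fun _ _ => False) (hm : 1 < m) (hn : 1 < n)
    (x y : ℤ) : (1 ≤ x ∧ x ≤ m ∧ 1 ≤ y ∧ y ≤ n) ↔ (x, y) ∈ P.vertexSet := by
  rw [mem_vertexSet, hF x y, hF (x - 1) y, hF x (y - 1), hF (x - 1) (y - 1)]
  simp only [not_false_eq_true, and_true]
  omega

theorem main_aux (K : Type) [Field K] (P : Polyomino)
    (D : FrameData) (hP : IsFrame P D) (h : Polynomial ℤ) (d : ℕ)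
    (hd : ringKrullDim (CoordRing K P) = (d : WithBot (WithTop ℕ)))
    (hh : hilbertSeries K P * (1 - PowerSeries.X) ^ d = (h : PowerSeries ℤ)) :
    ∀ k : ℕ, h.coeff k = (rtil P k : ℤ) := by
  have h1 := D.ha0
  have h2 := D.hak
  have h3 := D.ham
  have h4 := D.hb0
  have h5 := D.hbk
  have h6 := D.hbn
  have hcell : ∀ x y, (x, y) ∈ P.cells ↔ 1 ≤ x ∧ x < D.m ∧ 1 ≤ y ∧ y < D.n ∧ (x, y) ∉ D.holeCells := by
    intro x y
    rw [← Finset.mem_coe, hP]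
    simp only [FrameData.rectCells, Set.mem_sdiff, Set.mem_ofPred_eq]
    constructor
    · rintro ⟨⟨g1, g2, g3, g4⟩, g5⟩
      exact ⟨g1, by omega, g3, by omega, g5⟩
    · rintro ⟨g1, g2, g3, g4, g5⟩
      exact ⟨⟨g1, by omega, g3, by omega⟩, g5⟩
  rcases frame_or_rect D with ⟨F, e1, e2, e3, e4, hH⟩ | hH
  · have hF : FP P D.m D.n F.H := fun x y => by rw [hcell, hH]
    refine abstract_main K hF F.crossV F.crossC
      ((F.final sser_eq D.m D.n (by omega) (by omega)).ext (frame_vertex F hF (by omega) (by omega))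
        (fun x y => (hF x y).symm) rfl) h d hd hh
  · have hF : FP P D.m D.n (fun _ _ => False) := fun x y => by rw [hcell]; simp [hH]
    refine abstract_main K hF rect_crossV rect_crossC
      ((rect_final sser_eq D.m D.n (by omega) (by omega)).ext (rect_vertex hF (by omega) (by omega))
        (fun x y => by rw [hF x y]; simp) rfl) h d hd hh

end FrameAux

theorem frame_h_poly_eq_switching_rook_poly (K : Type) [Field K] (P : Polyomino)
    (D : FrameData) (hP : IsFrame P D) (h : Polynomial ℤ) (d : ℕ)
    (hd : ringKrullDim (CoordRing K P) = (d : WithBot (WithTop ℕ)))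
    (hh : hilbertSeries K P * (1 - PowerSeries.X) ^ d = (h : PowerSeries ℤ)) :
    ∀ k : ℕ, h.coeff k = (rtil P k : ℤ) := by
  exact FrameAux.main_aux K P D hP h d hd hh
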